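/- arXiv:1405.7913 — 6 statements merged into one kernel-verified Lean document; each statement's English description precedes it below -/
import Mathlib

section
/- Fix b ∈ [0,1). For v ∈ ℕ let α = (v + b)². Then lim_{v→∞} v^{3/2}·(𝒯(α) − π)/4 = (1/3)(2b+1)^{3/2} − √(2b) − ε(b), where ε(b) is the limit ε(b) = lim_{v→∞} v^{3/2} · Σ_{n=v₁+1}^{v−1} ∫_{n−1/2}^{n+1/2} ( √((v+b)² − n²)/n² − √((v+b)² − x²)/x² ) dx, with v₁ = ⌊(v+b)/√2⌋. -/
open Filter Topology intervalIntegral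

/-- The inverse branch `P⁻¹(x) = (x + ⌊√x⌋(1+⌊√x⌋))/(2⌊√x⌋+1)`. -/
noncomputable def Pinv (x : ℝ) : ℝ :=
  (x + (⌊Real.sqrt x⌋ : ℝ) * (1 + (⌊Real.sqrt x⌋ : ℝ))) / (2 * (⌊Real.sqrt x⌋ : ℝ) + 1)

/-- The period `𝒯(α)` of the integrable flow, via the explicit formula
`𝒯(α)/8 = P⁻¹(α/2)/(2v₁+1) − 2·Σ_{n=v₁+1}^{v_k} P⁻¹(α−n²)/(4n²−1)`, where
`v₁ = ⌊√(α/2)⌋` and `v_k = ⌊√α⌋`. -/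
noncomputable def Tper (α : ℝ) : ℝ :=
  8 * (Pinv (α / 2) / (2 * (⌊Real.sqrt (α / 2)⌋ : ℝ) + 1) -
    2 * ∑ n ∈ Finset.Icc (⌊Real.sqrt (α / 2)⌋ + 1) ⌊Real.sqrt α⌋,
      Pinv (α - (n : ℝ)^2) / (4 * (n : ℝ)^2 - 1))

/-- The rescaled error sum whose limit defines `ε(b)`:
`S(b,v) = v^{3/2}·Σ_{n=v₁+1}^{v−1} ∫_{n−1/2}^{n+1/2} (√((v+b)²−n²)/n² − √((v+b)²−x²)/x²) dx`,
with `v₁ = ⌊(v+b)/√2⌋`. -/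
noncomputable def Ssum (b : ℝ) (v : ℕ) : ℝ :=
  (v : ℝ) ^ ((3:ℝ)/2) *
    ∑ n ∈ Finset.Icc (⌊((v : ℝ) + b) / Real.sqrt 2⌋ + 1) ((v : ℤ) - 1),
      ∫ x in ((n : ℝ) - 1/2)..((n : ℝ) + 1/2),
        (Real.sqrt (((v : ℝ) + b)^2 - (n : ℝ)^2) / (n : ℝ)^2 -
         Real.sqrt (((v : ℝ) + b)^2 - x^2) / x^2)

lemma pinv_bound (x : ℝ) (hx : 0 ≤ x) : 0 ≤ Real.sqrt x - Pinv x ∧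
    Real.sqrt x - Pinv x ≤ 1 / (2 * (⌊Real.sqrt x⌋ : ℝ) + 1) ∧ 0 ≤ Pinv x := by
  have h1 := Int.floor_le (Real.sqrt x)
  have h2 := (Int.lt_floor_add_one (Real.sqrt x)).le
  have h0 : (0:ℝ) ≤ (⌊Real.sqrt x⌋ : ℝ) := by
    exact_mod_cast Int.floor_nonneg.mpr (Real.sqrt_nonneg x)
  have hs := Real.sq_sqrt hx
  unfold Pinv
  generalize (⌊Real.sqrt x⌋ : ℝ) = m at *
  generalize Real.sqrt x = s at *
  have hm : 0 < 2 * m + 1 := by linarith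
  have e : s - (x + m * (1 + m)) / (2 * m + 1) = (s - m) * (m + 1 - s) / (2 * m + 1) := by
    field_simp
    rw [← hs]; ring
  rw [e]
  refine ⟨div_nonneg (mul_nonneg (by linarith) (by linarith)) hm.le, ?_, by positivity⟩
  gcongr
  nlinarith

lemma sum_inv_sqrt (p v : ℕ) (hpv : p ≤ v) (hv : 1 ≤ v) :
    ∑ n ∈ Finset.Ico p v, 1 / (Real.sqrt v * Real.sqrt ((v:ℝ) - n)) ≤ 2 := by
  have hv' : 0 < Real.sqrt v := Real.sqrt_pos.mpr (by exact_mod_cast hv)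
  have h : ∀ n ∈ Finset.Ico p v, 1 / (Real.sqrt v * Real.sqrt ((v:ℝ) - n)) ≤
      (-2 / Real.sqrt v * Real.sqrt ((v:ℝ) - (n+1:ℕ))) - (-2 / Real.sqrt v * Real.sqrt ((v:ℝ) - n)) := by
    intro n hn
    have hn2 : (n:ℝ) + 1 ≤ v := by exact_mod_cast (Finset.mem_Ico.mp hn).2
    have ha : 0 < Real.sqrt ((v:ℝ) - n) := Real.sqrt_pos.mpr (by linarith)
    have hb := Real.sqrt_nonneg ((v:ℝ) - (n+1:ℕ))
    have ha2 := Real.sq_sqrt (show (0:ℝ) ≤ (v:ℝ) - n by linarith)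
    have hb2 := Real.sq_sqrt (show (0:ℝ) ≤ (v:ℝ) - (n+1:ℕ) by push_cast; linarith)
    push_cast at *
    generalize Real.sqrt ((v:ℝ) - n) = A at *
    generalize Real.sqrt ((v:ℝ) - (n+1)) = B at *
    have : (-2 / Real.sqrt v * B) - (-2 / Real.sqrt v * A) = (2 * (A - B) * A) / (Real.sqrt v * A) := by
      field_simp; ring
    rw [this]
    gcongr
    nlinarith [sq_nonneg (A - B)]
  refine (Finset.sum_le_sum h).trans ?_
  have hts := Finset.sum_Ico_sub (fun k : ℕ => -2 / Real.sqrt v * Real.sqrt ((v:ℝ) - k)) hpv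
  refine hts.le.trans ?_
  have : Real.sqrt ((v:ℝ) - p) ≤ Real.sqrt v := Real.sqrt_le_sqrt (sub_le_self _ p.cast_nonneg)
  simp only [sub_self, Real.sqrt_zero, mul_zero, zero_sub]
  rw [← neg_mul, neg_div, neg_neg, div_mul_eq_mul_div, div_le_iff₀ hv']
  linarith

noncomputable def GG (a x : ℝ) : ℝ := -(Real.sqrt (a^2 - x^2) / x) - Real.arcsin (x / a)

lemma GG_deriv (a x : ℝ) (hx : 0 < x) (hxa : x < a) :
    HasDerivAt (GG a) (Real.sqrt (a^2 - x^2) / x^2) x := by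
  have ha : 0 < a := hx.trans hxa
  have hpos : 0 < a^2 - x^2 := by nlinarith
  have hR : 0 < Real.sqrt (a^2 - x^2) := Real.sqrt_pos.mpr hpos
  have h1 : HasDerivAt (fun x : ℝ => a^2 - x^2) (-(2*x)) x := by
    simpa using (hasDerivAt_pow 2 x).const_sub (a^2)
  have h2 := (h1.sqrt hpos.ne').div (hasDerivAt_id x) hx.ne'
  have hlt : x / a < 1 := (div_lt_one ha).mpr hxa
  have hgt : 0 < x / a := by positivity
  have h3 := (Real.hasDerivAt_arcsin (x := x / a) (by linarith) hlt.ne).comp x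
    ((hasDerivAt_id x).div_const a)
  have h4 := h2.neg.sub h3
  have hs : Real.sqrt (1 - (x/a)^2) = Real.sqrt (a^2 - x^2) / a := by
    rw [show 1 - (x/a)^2 = (a^2 - x^2) / a^2 by field_simp, Real.sqrt_div hpos.le, Real.sqrt_sq ha.le]
  refine h4.congr_deriv ?_
  simp only [hs, id]
  have hR2 := Real.sq_sqrt hpos.le
  field_simp
  rw [hR2]; ring

lemma GG_int (a p q : ℝ) (hp : 0 < p) (hpq : p ≤ q) (hq : q < a) :
    IntervalIntegrable (fun x => Real.sqrt (a^2 - x^2) / x^2) MeasureTheory.volume p q ∧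
    ∫ x in p..q, Real.sqrt (a^2 - x^2) / x^2 = GG a q - GG a p := by
  have hi : IntervalIntegrable (fun x => Real.sqrt (a^2 - x^2) / x^2) MeasureTheory.volume p q := by
    apply ContinuousOn.intervalIntegrable
    rw [Set.uIcc_of_le hpq]
    apply ContinuousOn.div (by fun_prop) (by fun_prop)
    intro x hx
    have : 0 < x := hp.trans_le hx.1
    positivity
  refine ⟨hi, integral_eq_sub_of_hasDerivAt ?_ hi⟩
  intro x hx
  rw [Set.uIcc_of_le hpq] at hx
  exact GG_deriv a x (hp.trans_le hx.1) (hx.2.trans_lt hq)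

lemma F_bound (a c : ℝ) (ha : 4 ≤ a) (hc : |c - a / Real.sqrt 2| ≤ 1/2) :
    |a / Real.sqrt 2 / c + GG a c + Real.pi / 4| ≤ 6 / a^2 := by
  set A := a / Real.sqrt 2 with hA
  have h2 : 0 < Real.sqrt 2 := by positivity
  have hs2 : Real.sqrt 2 < 1.5 := by rw [Real.sqrt_lt' (by norm_num)]; norm_num
  have hA2 : A^2 = a^2 / 2 := by rw [hA, div_pow, Real.sq_sqrt (by norm_num)]
  have hApos : 0 < A := by positivity
  have hA1 : 2 ≤ A := by nlinarith
  have hAa : A + 1/2 < a := by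
    rw [hA]
    have h14 : 1.4 < Real.sqrt 2 := by rw [Real.lt_sqrt (by norm_num)]; norm_num
    have : a / Real.sqrt 2 ≤ a / 1.4 := by gcongr
    have h3: a / 1.4 = a * (5/7) := by ring
    linarith
  have hFA : A / A + GG a A = -(Real.pi/4) := by
    have e1 : Real.sqrt (a^2 - A^2) = A := by
      rw [show a^2 - A^2 = A^2 by rw [hA2]; ring, Real.sqrt_sq hApos.le]
    have e2 : A / a = Real.sin (Real.pi/4) := by
      rw [Real.sin_pi_div_four, hA]
      field_simp
      rw [Real.sq_sqrt (by norm_num)]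
    have e3 : Real.arcsin (A / a) = Real.pi / 4 := by
      rw [e2, Real.arcsin_sin] <;> linarith [Real.pi_pos]
    unfold GG
    rw [e1, e3]; ring
  have key : ‖(fun x => A / x + GG a x) c - (fun x => A / x + GG a x) A‖ ≤ (12 / a^2) * ‖c - A‖ := by
    apply Convex.norm_image_sub_le_of_norm_hasDerivWithin_le (f := fun x => A / x + GG a x) (s := Set.Icc (A - 1/2) (A + 1/2))
      (f' := fun x => -A / x^2 + Real.sqrt (a^2 - x^2) / x^2)
    · intro x hx
      have hx0 : 0 < x := by linarith [hx.1]
      have hd : HasDerivAt (fun x : ℝ => A / x) (-A / x^2) x := by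
        simpa [div_eq_mul_inv] using (hasDerivAt_inv hx0.ne').const_mul A
      exact (hd.add (GG_deriv a x hx0 (by linarith [hx.2]))).hasDerivWithinAt
    · intro x hx
      obtain ⟨hx1, hx2⟩ := hx
      have hx0 : 0 < x := by linarith
      have hR := Real.sqrt_nonneg (a^2 - x^2)
      have hR2 := Real.sq_sqrt (show 0 ≤ a^2 - x^2 by nlinarith)
      set R := Real.sqrt (a^2 - x^2)
      rw [Real.norm_eq_abs, ← add_div, abs_div, abs_of_pos (show 0 < x^2 by positivity)]
      have hb : |-A + R| ≤ 3/2 := by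
        have h5 : (R - A) * (R + A) = (A - x) * (A + x) := by nlinarith
        have h6 : |R - A| * (R + A) = |A - x| * (A + x) := by
          rw [← abs_of_pos (show 0 < R + A by linarith), ← abs_mul, h5, abs_mul,
            abs_of_pos (show 0 < A + x by linarith)]
        have h7 : |A - x| ≤ 1/2 := abs_le.mpr ⟨by linarith, by linarith⟩
        have h8 : |R - A| * A ≤ 3/2 * A := by
          nlinarith [abs_nonneg (R - A), abs_nonneg (A - x)]
        rw [neg_add_eq_sub]
        exact le_of_mul_le_mul_right h8 hApos
      rw [div_le_div_iff₀ (by positivity) (by positivity)]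
      have h9 : a^2 ≤ 8 * x^2 := by nlinarith
      nlinarith
    · exact convex_Icc _ _
    · constructor <;> linarith
    · obtain ⟨h, h'⟩ := abs_le.mp hc
      constructor <;> linarith
  simp only [hFA, Real.norm_eq_abs] at key
  rw [sub_neg_eq_add] at key
  refine key.trans ?_
  calc 12 / a^2 * |c - A| ≤ 12 / a^2 * (1/2) := by gcongr
    _ = 6 / a^2 := by ring

lemma tan_lim : Tendsto (fun x : ℝ => (Real.tan x - x) / Real.sin x ^ 3) (𝓝[≠] 0) (𝓝 (1/3)) := by
  have hsin : Tendsto (fun x : ℝ => Real.sin x / x) (𝓝[≠] 0) (𝓝 1) := by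
    have := (Real.hasDerivAt_sin 0).tendsto_slope_zero
    simpa [div_eq_inv_mul] using this
  have hcos : Tendsto (fun x : ℝ => Real.cos x) (𝓝[≠] 0) (𝓝 1) := by
    have := Real.continuous_cos.tendsto 0
    rw [Real.cos_zero] at this
    exact this.mono_left nhdsWithin_le_nhds
  have hc0 : ∀ᶠ x in 𝓝[≠] (0:ℝ), Real.cos x ≠ 0 := hcos.eventually_ne (by norm_num)
  have h1 : Tendsto (fun x : ℝ => (Real.tan x - x) / x ^ 3) (𝓝[≠] 0) (𝓝 (1/3)) := by
    apply HasDerivAt.lhopital_zero_nhdsNE (f' := fun x => 1 / Real.cos x ^ 2 - 1) (g' := fun x => 3 * x^2)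
    · filter_upwards [hc0] with x hx
      exact (Real.hasDerivAt_tan hx).sub (hasDerivAt_id x)
    · filter_upwards with x
      simpa using hasDerivAt_pow 3 x
    · filter_upwards [self_mem_nhdsWithin] with x hx
      have : x ≠ 0 := hx
      positivity
    · have : ContinuousAt (fun x : ℝ => Real.tan x - x) 0 :=
        (Real.continuousAt_tan.mpr (by simp)).sub continuousAt_id
      have := this.tendsto
      simp only [Real.tan_zero, sub_zero] at this
      exact this.mono_left nhdsWithin_le_nhds
    · have : Tendsto (fun x : ℝ => x^3) (𝓝 0) (𝓝 (0^3)) := (continuous_pow 3).tendsto 0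
      simp only [ne_eq, OfNat.ofNat_ne_zero, not_false_eq_true, zero_pow] at this
      exact this.mono_left nhdsWithin_le_nhds
    · have : Tendsto (fun x : ℝ => (Real.sin x / x)^2 / (3 * Real.cos x ^ 2)) (𝓝[≠] 0) (𝓝 (1^2/(3*1^2))) :=
        (hsin.pow 2).div ((hcos.pow 2).const_mul 3) (by norm_num)
      norm_num at this
      refine this.congr' ?_
      filter_upwards [hc0, self_mem_nhdsWithin] with x hx hx0
      have : x ≠ 0 := hx0
      have := Real.sin_sq_add_cos_sq x
      field_simp
      linarith
  have h2 := h1.div (hsin.pow 3) (by norm_num)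
  norm_num at h2
  refine h2.congr' ?_
  filter_upwards [self_mem_nhdsWithin] with x hx0
  have : x ≠ 0 := hx0
  simp only [Pi.div_apply]
  field_simp

lemma sum_int_nat (f : ℤ → ℝ) (p q : ℕ) :
    ∑ n ∈ Finset.Icc (p:ℤ) ((q:ℤ) - 1), f n = ∑ n ∈ Finset.Ico p q, f (n:ℤ) := by
  symm
  refine Finset.sum_nbij' (fun n : ℕ => (n:ℤ)) Int.toNat ?_ ?_ ?_ ?_ ?_
  · intro n hn; simp only [Finset.mem_Ico, Finset.mem_Icc] at *; omega
  · intro n hn; simp only [Finset.mem_Ico, Finset.mem_Icc] at *; omega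
  · intro n hn; simp
  · intro n hn; simp only [Finset.mem_Icc] at *; omega
  · intro n hn; rfl

noncomputable def Serr (b : ℝ) (v : ℕ) : ℝ :=
    ∑ n ∈ Finset.Icc (⌊((v : ℝ) + b) / Real.sqrt 2⌋ + 1) ((v : ℤ) - 1),
      ∫ x in ((n : ℝ) - 1/2)..((n : ℝ) + 1/2),
        (Real.sqrt (((v : ℝ) + b)^2 - (n : ℝ)^2) / (n : ℝ)^2 -
         Real.sqrt (((v : ℝ) + b)^2 - x^2) / x^2)

lemma Serr_eq (b : ℝ) (hb : 0 ≤ b) (v w : ℕ) (hw : w + 1 ≤ v)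
    (hf : ⌊((v : ℝ) + b) / Real.sqrt 2⌋ = (w:ℤ)) :
    Serr b v = ∑ n ∈ Finset.Ico (w+1) v, Real.sqrt (((v : ℝ) + b)^2 - (n : ℝ)^2) / (n : ℝ)^2
      - (GG (v + b) ((v:ℝ) - 1/2) - GG (v + b) ((w:ℝ) + 1/2)) := by
  unfold Serr
  rw [hf]
  have := sum_int_nat (fun n : ℤ => ∫ x in ((n : ℝ) - 1/2)..((n : ℝ) + 1/2),
        (Real.sqrt (((v : ℝ) + b)^2 - (n : ℝ)^2) / (n : ℝ)^2 -
         Real.sqrt (((v : ℝ) + b)^2 - x^2) / x^2)) (w+1) v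
  push_cast at this
  rw [this]
  have h : ∀ n ∈ Finset.Ico (w+1) v, (∫ x in ((n : ℝ) - 1/2)..((n : ℝ) + 1/2),
        (Real.sqrt (((v : ℝ) + b)^2 - (n : ℝ)^2) / (n : ℝ)^2 -
         Real.sqrt (((v : ℝ) + b)^2 - x^2) / x^2)) =
      Real.sqrt (((v : ℝ) + b)^2 - (n : ℝ)^2) / (n : ℝ)^2 -
        ((fun k : ℕ => GG (v + b) ((k:ℝ) - 1/2)) (n+1) - (fun k : ℕ => GG (v + b) ((k:ℝ) - 1/2)) n) := by
    intro n hn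
    rw [Finset.mem_Ico] at hn
    have h1 : (w:ℝ) + 1 ≤ n := by exact_mod_cast hn.1
    have h2 : (n:ℝ) + 1 ≤ v := by exact_mod_cast hn.2
    have h0 : (0:ℝ) ≤ w := w.cast_nonneg
    obtain ⟨hi, he⟩ := GG_int (v + b) ((n:ℝ) - 1/2) (n + 1/2) (by linarith) (by linarith) (by linarith)
    rw [intervalIntegral.integral_sub (by simp) hi, he, intervalIntegral.integral_const]
    push_cast
    rw [show (n:ℝ) + 1 - 1/2 = n + 1/2 by ring, show (n:ℝ) + 1/2 - (n - 1/2) = 1 by ring, one_smul]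
  rw [Finset.sum_congr rfl h, Finset.sum_sub_distrib,
    Finset.sum_Ico_sub (fun k : ℕ => GG (v + b) ((k:ℝ) - 1/2)) hw]
  push_cast
  rw [show (w:ℝ) + 1 - 1/2 = w + 1/2 by ring]

lemma term_bound (a v : ℝ) (n : ℝ) (hv : 1 ≤ v) (hva : v ≤ a) (hn1 : a^2 / 2 ≤ n^2) (hn0 : 1 ≤ n) (hn : n ≤ v)
    (B : ℝ) (hB : Real.sqrt (a^2 - n^2) - Pinv (a^2 - n^2) ≤ B) :
    |Real.sqrt (a^2 - n^2) / n^2 - 4 * (Pinv (a^2 - n^2) / (4 * n^2 - 1))| ≤ 2 / v^2 * (B + 2 / v) := by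
  have hnn : 0 ≤ a^2 - n^2 := by nlinarith
  obtain ⟨h1, -, h3⟩ := pinv_bound _ hnn
  have hRn : Real.sqrt (a^2 - n^2) ≤ n := by
    rw [Real.sqrt_le_left (by linarith)]; linarith
  generalize Real.sqrt (a^2 - n^2) = R at *
  generalize Pinv (a^2 - n^2) = P at *
  have hp : 0 < 4 * n^2 - 1 := by nlinarith
  have e : R / n^2 - 4 * (P / (4 * n^2 - 1)) = (R - P) / n^2 - P / (n^2 * (4 * n^2 - 1)) := by
    have hp' := hp.ne'
    have hn' : n ≠ 0 := by positivity
    generalize hq : 4 * n^2 - 1 = q at *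
    field_simp
    rw [← hq]; ring
  have hB0 : 0 ≤ B := h1.trans hB
  have hvn : 2 / v^2 ≥ 1 / n^2 := by
    rw [ge_iff_le, div_le_div_iff₀ (by positivity) (by positivity)]; nlinarith
  have hvn' : v ≤ 2 * n := by nlinarith
  have b1 : (R - P) / n^2 ≤ 2 / v^2 * B := by
    calc (R - P) / n^2 = 1 / n^2 * (R - P) := by ring
      _ ≤ 2 / v^2 * B := by gcongr
  have b2 : P / (n^2 * (4 * n^2 - 1)) ≤ 2 / v^2 * (2 / v) := by
    calc P / (n^2 * (4 * n^2 - 1)) = 1 / n^2 * (P / (4 * n^2 - 1)) := by field_simp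
      _ ≤ 2 / v^2 * (2 / v) := by
        have h9 : P / (4 * n^2 - 1) ≤ 2 / v := by
          rw [div_le_div_iff₀ hp (by positivity)]
          nlinarith
        exact mul_le_mul hvn h9 (by positivity) (by positivity)
  have b3 : 0 ≤ (R - P) / n^2 := by positivity
  have b4 : 0 ≤ P / (n^2 * (4 * n^2 - 1)) := by positivity
  have b5 : 0 ≤ 2 / v^2 * B := by positivity
  have b6 : 0 ≤ 2 / v^2 * (2 / v) := by positivity
  rw [e, abs_le, mul_add]
  constructor <;> linarith

set_option maxHeartbeats 1600000 in
lemma main_bound (b : ℝ) (hb : b ∈ Set.Ico (0:ℝ) 1) (v : ℕ) (hv : 10 ≤ v) :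
    |(Tper (((v : ℝ) + b)^2) - Real.pi) / 4 -
      ((Real.tan (Real.arccos (((v:ℝ) - 1/2) / (v + b))) - Real.arccos (((v:ℝ) - 1/2) / (v + b)))
        - Serr b v - Real.sqrt (((v:ℝ) + b)^2 - v^2) / v^2)| ≤ 20 / (v:ℝ)^2 := by
  obtain ⟨hb0, hb1⟩ := hb
  have hv' : (10:ℝ) ≤ v := by exact_mod_cast hv
  set a : ℝ := v + b with ha
  have ha0 : 0 < a := by linarith
  have h14 : 1.4 < Real.sqrt 2 := by rw [Real.lt_sqrt (by norm_num)]; norm_num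
  have h2 : 0 < Real.sqrt 2 := by positivity
  have hA0 : 0 ≤ a / Real.sqrt 2 := by positivity
  have hAsq : (a / Real.sqrt 2)^2 = a^2 / 2 := by rw [div_pow, Real.sq_sqrt (by norm_num)]
  obtain ⟨w, hw⟩ : ∃ w : ℕ, ⌊a / Real.sqrt 2⌋ = (w:ℤ) :=
    Int.eq_ofNat_of_zero_le (Int.floor_nonneg.mpr hA0)
  have hw1 : (w:ℝ) ≤ a / Real.sqrt 2 := by
    have := Int.floor_le (a / Real.sqrt 2); rw [hw] at this; exact_mod_cast this
  have hw2 : a / Real.sqrt 2 < w + 1 := by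
    have := Int.lt_floor_add_one (a / Real.sqrt 2); rw [hw] at this; exact_mod_cast this
  have hwv' : (w:ℝ) + 1 ≤ v := by
    have h5 : a / Real.sqrt 2 ≤ a / 1.4 := by gcongr
    have h3 : a / 1.4 = a * (5/7) := by ring
    linarith
  have hwv : w + 1 ≤ v := by exact_mod_cast hwv'
  have hw0 : (0:ℝ) ≤ w := w.cast_nonneg
  have hsa : Real.sqrt (a^2) = a := Real.sqrt_sq ha0.le
  have hsa2 : Real.sqrt (a^2/2) = a / Real.sqrt 2 := by
    rw [← hAsq, Real.sqrt_sq hA0]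
  have hfa : ⌊a⌋ = (v:ℤ) := by
    rw [Int.floor_eq_iff]; push_cast; constructor <;> linarith
  -- unfold the period
  have hT : Tper (a^2) / 4 = 2 * (Pinv (a^2/2) / (2 * w + 1)) -
      ∑ n ∈ Finset.Ico (w+1) (v+1), 4 * (Pinv (a^2 - (n:ℝ)^2) / (4 * (n:ℝ)^2 - 1)) := by
    unfold Tper
    rw [hsa, hsa2, hfa, hw]
    have := sum_int_nat (fun n : ℤ => Pinv (a^2 - (n : ℝ)^2) / (4 * (n : ℝ)^2 - 1)) (w+1) (v+1)
    push_cast at this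
    rw [add_sub_cancel_right] at this
    rw [this, ← Finset.mul_sum]
    push_cast
    ring
  have hS := Serr_eq b hb0 v w hwv hw
  rw [← ha] at hS
  -- first error
  obtain ⟨p1, p2, -⟩ := pinv_bound (a^2/2) (by positivity)
  rw [hsa2] at p1 p2
  rw [hw] at p2
  push_cast at p2
  have hE1 : |2 * (Pinv (a^2/2) / (2 * w + 1)) - a / Real.sqrt 2 / (w + 1/2)| ≤ 4 / (v:ℝ)^2 := by
    have e : 2 * (Pinv (a^2/2) / (2 * w + 1)) - a / Real.sqrt 2 / (w + 1/2)
      = - (2 * (a / Real.sqrt 2 - Pinv (a^2/2)) / (2 * w + 1)) := by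
      generalize a / Real.sqrt 2 = A
      field_simp; ring
    rw [e, abs_neg, abs_of_nonneg (by positivity)]
    calc 2 * (a / Real.sqrt 2 - Pinv (a^2/2)) / (2 * w + 1) ≤ 2 * (1 / (2 * w + 1)) / (2 * w + 1) := by gcongr
      _ = 2 / (2 * w + 1)^2 := by field_simp
      _ ≤ 4 / (v:ℝ)^2 := by
        rw [div_le_div_iff₀ (by positivity) (by positivity)]
        have : (a / Real.sqrt 2)^2 ≤ (2 * w + 1)^2 := by gcongr; linarith
        nlinarith
  have hF := F_bound a (w + 1/2) (by linarith) (abs_le.mpr ⟨by linarith, by linarith⟩)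
  have hF' : 6 / a^2 ≤ 6 / (v:ℝ)^2 := by gcongr; linarith
  -- the sum error
  have hgn : ∀ n ∈ Finset.Ico (w+1) (v+1), a^2 / 2 ≤ (n:ℝ)^2 ∧ (1:ℝ) ≤ n ∧ (n:ℝ) ≤ v := by
    intro n hn
    rw [Finset.mem_Ico] at hn
    have h1 : (w:ℝ) + 1 ≤ n := by exact_mod_cast hn.1
    have h3 : (n:ℝ) ≤ v := by exact_mod_cast Nat.lt_succ_iff.mp hn.2
    refine ⟨?_, by linarith, h3⟩
    rw [← hAsq]; gcongr; linarith
  have hE2 : |∑ n ∈ Finset.Ico (w+1) (v+1), (Real.sqrt (a^2 - (n:ℝ)^2) / (n:ℝ)^2 -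
      4 * (Pinv (a^2 - (n:ℝ)^2) / (4 * (n:ℝ)^2 - 1)))| ≤ 10 / (v:ℝ)^2 := by
    refine (Finset.abs_sum_le_sum_abs _ _).trans ?_
    rw [Finset.sum_Ico_succ_top hwv]
    have t1 : |Real.sqrt (a^2 - (v:ℝ)^2) / (v:ℝ)^2 -
      4 * (Pinv (a^2 - (v:ℝ)^2) / (4 * (v:ℝ)^2 - 1))| ≤ 2 / (v:ℝ)^2 * (1 + 2 / v) := by
      obtain ⟨g1, g2, g3⟩ := hgn v (Finset.mem_Ico.mpr ⟨hwv, by omega⟩)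
      apply term_bound a v v (by linarith) (by linarith) g1 g2 g3
      have hx : 0 ≤ a^2 - (v:ℝ)^2 := by nlinarith
      refine (pinv_bound _ hx).2.1.trans ?_
      have : (0:ℝ) ≤ (⌊Real.sqrt (a^2 - (v:ℝ)^2)⌋ : ℝ) := by
        exact_mod_cast Int.floor_nonneg.mpr (Real.sqrt_nonneg _)
      rw [div_le_one (by positivity)]
      linarith
    have t2 : ∑ n ∈ Finset.Ico (w+1) v, |Real.sqrt (a^2 - (n:ℝ)^2) / (n:ℝ)^2 -
      4 * (Pinv (a^2 - (n:ℝ)^2) / (4 * (n:ℝ)^2 - 1))| ≤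
      ∑ n ∈ Finset.Ico (w+1) v, 2 / (v:ℝ)^2 * (1 / (Real.sqrt v * Real.sqrt ((v:ℝ) - n)) + 2 / v) := by
      apply Finset.sum_le_sum
      intro n hn
      have hn' := Finset.mem_Ico.mp hn
      obtain ⟨g1, g2, g3⟩ := hgn n (Finset.mem_Ico.mpr ⟨hn'.1, by omega⟩)
      have g4 : (n:ℝ) + 1 ≤ v := by exact_mod_cast hn'.2
      apply term_bound a v n (by linarith) (by linarith) g1 g2 g3
      have hx : 0 ≤ a^2 - (n:ℝ)^2 := by nlinarith
      refine (pinv_bound _ hx).2.1.trans ?_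
      have hfl : (0:ℝ) ≤ (⌊Real.sqrt (a^2 - (n:ℝ)^2)⌋ : ℝ) := by
        exact_mod_cast Int.floor_nonneg.mpr (Real.sqrt_nonneg _)
      have hlt := Int.lt_floor_add_one (Real.sqrt (a^2 - (n:ℝ)^2))
      have q1 : 0 < Real.sqrt v := Real.sqrt_pos.mpr (by linarith)
      have q2 : 0 < Real.sqrt ((v:ℝ) - n) := Real.sqrt_pos.mpr (by linarith)
      have q3 : Real.sqrt v * Real.sqrt ((v:ℝ) - n) ≤ Real.sqrt (a^2 - (n:ℝ)^2) := by
        rw [← Real.sqrt_mul (by linarith)]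
        apply Real.sqrt_le_sqrt
        nlinarith
      apply one_div_le_one_div_of_le (by positivity)
      linarith
    have t3 : ∑ n ∈ Finset.Ico (w+1) v, 2 / (v:ℝ)^2 * (1 / (Real.sqrt v * Real.sqrt ((v:ℝ) - n)) + 2 / v)
      ≤ 2 / (v:ℝ)^2 * (2 + ((v:ℝ) - 1) * (2 / v)) := by
      rw [← Finset.mul_sum, Finset.sum_add_distrib]
      have := sum_inv_sqrt (w+1) v hwv (by omega)
      rw [Finset.sum_const, Nat.card_Ico, nsmul_eq_mul]
      gcongr
      rw [Nat.cast_sub hwv]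
      push_cast
      linarith
    calc _ ≤ 2 / (v:ℝ)^2 * (2 + ((v:ℝ) - 1) * (2 / v)) + 2 / (v:ℝ)^2 * (1 + 2 / v) := by linarith
      _ = 10 / (v:ℝ)^2 := by field_simp; ring
  rw [Finset.sum_sub_distrib, Finset.sum_Ico_succ_top hwv] at hE2
  -- the tail
  have htail : Real.tan (Real.arccos (((v:ℝ) - 1/2) / a)) - Real.arccos (((v:ℝ) - 1/2) / a)
      = - GG a ((v:ℝ) - 1/2) - Real.pi / 2 := by
    have hd : 0 < (v:ℝ) - 1/2 := by linarith
    unfold GG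
    rw [Real.tan_arccos, Real.arcsin_eq_pi_div_two_sub_arccos]
    have hpos : 0 ≤ a^2 - ((v:ℝ) - 1/2)^2 := by nlinarith
    generalize (v:ℝ) - 1/2 = d at *
    rw [show 1 - (d/a)^2 = (a^2 - d^2) / a^2 by field_simp, Real.sqrt_div hpos, Real.sqrt_sq ha0.le]
    have : Real.sqrt (a^2 - d^2) / a / (d / a) = Real.sqrt (a^2 - d^2) / d := by field_simp
    rw [this]; ring
  rw [htail, hS, sub_div, hT]
  have h20 : 20 / (v:ℝ)^2 = 4 / (v:ℝ)^2 + 6 / (v:ℝ)^2 + 10 / (v:ℝ)^2 := by ring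
  rw [h20]
  obtain ⟨x1, x2⟩ := abs_le.mp hE1
  obtain ⟨y1, y2⟩ := abs_le.mp (hF.trans hF')
  obtain ⟨z1, z2⟩ := abs_le.mp hE2
  rw [abs_le]
  constructor <;> linarith

lemma rpow_th (v : ℕ) : (v:ℝ) ^ ((3:ℝ)/2) = Real.sqrt v ^ 3 := by
  rw [Real.sqrt_eq_rpow, ← Real.rpow_natCast, ← Real.rpow_mul v.cast_nonneg]
  norm_num

lemma inv_lim : Tendsto (fun v : ℕ => 1 / (v:ℝ)) atTop (𝓝 0) := tendsto_one_div_atTop_nhds_zero_nat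

lemma tail_lim (b : ℝ) (hb : 0 ≤ b) : Tendsto (fun v : ℕ => (v:ℝ) ^ ((3:ℝ)/2) *
    (Real.tan (Real.arccos (((v:ℝ) - 1/2) / (v + b))) - Real.arccos (((v:ℝ) - 1/2) / (v + b))))
    atTop (𝓝 ((1/3) * (2*b+1) ^ ((3:ℝ)/2))) := by
  have hev : ∀ᶠ v : ℕ in atTop, (1:ℝ) ≤ v := by
    filter_upwards [eventually_ge_atTop 1] with v hv
    exact_mod_cast hv
  have hy : Tendsto (fun v : ℕ => ((v:ℝ) - 1/2) / (v + b)) atTop (𝓝 1) := by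
    have : Tendsto (fun v : ℕ => (1 - 1/2 * (1 / (v:ℝ))) / (1 + b * (1 / (v:ℝ)))) atTop
        (𝓝 ((1 - 1/2 * 0) / (1 + b * 0))) :=
      ((inv_lim.const_mul (1/2)).const_sub 1).div ((inv_lim.const_mul b).const_add 1) (by norm_num)
    norm_num at this
    refine this.congr' ?_
    filter_upwards [hev] with v hv
    have : 0 < (v:ℝ) + b := by linarith
    field_simp
  have hθ : Tendsto (fun v : ℕ => Real.arccos (((v:ℝ) - 1/2) / (v + b))) atTop (𝓝[≠] 0) := by
    rw [tendsto_nhdsWithin_iff]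
    constructor
    · have := (Real.continuous_arccos.tendsto 1).comp hy
      rwa [Real.arccos_one] at this
    · filter_upwards [hev] with v hv
      have : 0 < Real.arccos (((v:ℝ) - 1/2) / (v + b)) := by
        rw [Real.arccos_pos, div_lt_one (by linarith)]; linarith
      exact this.ne'
  have h1 := tan_lim.comp hθ
  have h2 : Tendsto (fun v : ℕ => Real.sqrt v * Real.sin (Real.arccos (((v:ℝ) - 1/2) / (v + b)))) atTop
      (𝓝 (Real.sqrt (2*b+1))) := by
    have : Tendsto (fun v : ℕ => (b + 1/2) * (2 + (b - 1/2) * (1 / (v:ℝ))) / (1 + b * (1 / (v:ℝ)))^2) atTop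
        (𝓝 ((b + 1/2) * (2 + (b - 1/2) * 0) / (1 + b * 0)^2)) :=
      (((inv_lim.const_mul (b - 1/2)).const_add 2).const_mul (b + 1/2)).div
        (((inv_lim.const_mul b).const_add 1).pow 2) (by norm_num)
    rw [show (b + 1/2) * (2 + (b - 1/2) * 0) / (1 + b * 0)^2 = 2*b+1 by norm_num; ring] at this
    have := (Real.continuous_sqrt.tendsto _).comp this
    refine this.congr' ?_
    filter_upwards [hev] with v hv
    have h0 : 0 < (v:ℝ) + b := by linarith
    rw [Real.sin_arccos, ← Real.sqrt_mul v.cast_nonneg]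
    simp only [Function.comp]
    congr 1
    field_simp
    ring
  have h3 := h1.mul (h2.pow 3)
  have e : Real.sqrt (2*b+1) ^ 3 = (2*b+1) ^ ((3:ℝ)/2) := by
    rw [Real.sqrt_eq_rpow, ← Real.rpow_natCast, ← Real.rpow_mul (by linarith)]
    norm_num
  rw [e] at h3
  refine h3.congr' ?_
  filter_upwards [hev] with v hv
  have hs : Real.sin (Real.arccos (((v:ℝ) - 1/2) / (v + b))) ≠ 0 := by
    have h0 : 0 < (v:ℝ) + b := by linarith
    rw [Real.sin_arccos]
    refine (Real.sqrt_pos.mpr ?_).ne'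
    have a1 : ((v:ℝ) - 1/2) / (v + b) < 1 := by rw [div_lt_one h0]; linarith
    have a2 : 0 < ((v:ℝ) - 1/2) / (v + b) := div_pos (by linarith) h0
    nlinarith
  rw [rpow_th]
  simp only [Function.comp]
  generalize Real.arccos (((v:ℝ) - 1/2) / (v + b)) = t at *
  field_simp

lemma last_lim (b : ℝ) (hb : 0 ≤ b) : Tendsto (fun v : ℕ => (v:ℝ) ^ ((3:ℝ)/2) *
    (Real.sqrt (((v:ℝ) + b)^2 - v^2) / v^2)) atTop (𝓝 (Real.sqrt (2*b))) := by
  have : Tendsto (fun v : ℕ => 2 * b + b^2 * (1 / (v:ℝ))) atTop (𝓝 (2 * b + b^2 * 0)) :=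
    (inv_lim.const_mul (b^2)).const_add (2*b)
  rw [mul_zero, add_zero] at this
  have := (Real.continuous_sqrt.tendsto _).comp this
  refine this.congr' ?_
  filter_upwards [eventually_ge_atTop 1] with v hv
  have hv' : (0:ℝ) < v := by exact_mod_cast hv
  have hs : 0 < Real.sqrt v := Real.sqrt_pos.mpr hv'
  have hs2 := Real.sq_sqrt hv'.le
  rw [rpow_th]
  simp only [Function.comp]
  have e : ((v:ℝ) + b)^2 - v^2 = (2 * b + b^2 * (1 / (v:ℝ))) * v := by field_simp; ring
  rw [e, Real.sqrt_mul (by positivity)]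
  generalize Real.sqrt (2 * b + b^2 * (1 / (v:ℝ))) = X
  rw [show (v:ℝ)^2 = Real.sqrt v ^ 4 by rw [← hs2]; ring_nf; rw [hs2]]
  field_simp

lemma err_lim : Tendsto (fun v : ℕ => (v:ℝ) ^ ((3:ℝ)/2) * (20 / (v:ℝ)^2)) atTop (𝓝 0) := by
  have := ((Real.continuous_sqrt.tendsto _).comp inv_lim).const_mul 20
  rw [Real.sqrt_zero, mul_zero] at this
  refine this.congr' ?_
  filter_upwards [eventually_ge_atTop 1] with v hv
  have hv' : (0:ℝ) < v := by exact_mod_cast hv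
  have hs : 0 < Real.sqrt v := Real.sqrt_pos.mpr hv'
  have hs2 := Real.sq_sqrt hv'.le
  rw [rpow_th]
  simp only [Function.comp]
  rw [Real.sqrt_div zero_le_one, Real.sqrt_one]
  rw [show (v:ℝ)^2 = Real.sqrt v ^ 4 by rw [show Real.sqrt v ^ 4 = (Real.sqrt v ^ 2)^2 by ring, hs2]]
  field_simp

/-- Fix `b ∈ [0,1)` and let `α = (v+b)²`.  If `ε` is the limit of the error sums
`S(b,v)`, then `v^{3/2}(𝒯(α) − π)/4 → (1/3)(2b+1)^{3/2} − √(2b) − ε` as `v → ∞`. -/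
theorem period_asymptotics (b : ℝ) (hb : b ∈ Set.Ico (0:ℝ) 1) (ε : ℝ)
    (hε : Tendsto (fun v : ℕ => Ssum b v) atTop (nhds ε)) :
    Tendsto
      (fun v : ℕ => (v : ℝ) ^ ((3:ℝ)/2) * ((Tper (((v : ℝ) + b)^2) - Real.pi) / 4))
      atTop
      (nhds ((1/3) * (2*b+1) ^ ((3:ℝ)/2) - Real.sqrt (2*b) - ε)) := by
  have hlim := ((tail_lim b hb.1).sub (last_lim b hb.1)).sub hε
  have hdiff : Tendsto (fun v : ℕ => (v : ℝ) ^ ((3:ℝ)/2) * ((Tper (((v : ℝ) + b)^2) - Real.pi) / 4) -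
      ((v:ℝ) ^ ((3:ℝ)/2) *
    (Real.tan (Real.arccos (((v:ℝ) - 1/2) / (v + b))) - Real.arccos (((v:ℝ) - 1/2) / (v + b))) -
      (v:ℝ) ^ ((3:ℝ)/2) * (Real.sqrt (((v:ℝ) + b)^2 - v^2) / v^2) - Ssum b v)) atTop (𝓝 0) := by
    apply squeeze_zero_norm' _ err_lim
    filter_upwards [eventually_ge_atTop 10] with v hv
    have hS : Ssum b v = (v:ℝ) ^ ((3:ℝ)/2) * Serr b v := rfl
    have h0 : 0 ≤ (v:ℝ) ^ ((3:ℝ)/2) := by positivity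
    have := mul_le_mul_of_nonneg_left (main_bound b hb v hv) h0
    refine le_trans (le_of_eq ?_) this
    rw [hS, Real.norm_eq_abs]
    nth_rw 5 [← abs_of_nonneg h0]
    rw [← abs_mul]
    congr 1
    ring
  have := hdiff.add hlim
  rw [zero_add] at this
  refine this.congr ?_
  intro v
  ring
end

section
/- There exist constants C > 0 and α₀ > 0 such that for all α ≥ α₀, | Σ_{n=v₁+1}^{v_k} ( P⁻¹(α − n²)/(4n² − 1) − √(α − n²)/(4n²) ) | ≤ C/α, where v₁ = ⌊√(α/2)⌋ and v_k = ⌊√α⌋. -/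
open Filter Topology

/-- The identity `P⁻¹(x) - √x = -t(1-t)/(2m+1)`, turned into a bound. -/
lemma Pinv_sub_sqrt_le (x : ℝ) (hx : 0 ≤ x) :
    |Pinv x - Real.sqrt x| ≤ 1 / (4 * (2 * (⌊Real.sqrt x⌋ : ℝ) + 1)) := by
  unfold Pinv
  have hs : Real.sqrt x ^ 2 = x := Real.sq_sqrt hx
  have hs0 := Real.sqrt_nonneg x
  set s := Real.sqrt x with hsdef
  have h1 : (⌊s⌋ : ℝ) ≤ s := Int.floor_le s
  have h2 : s < (⌊s⌋ : ℝ) + 1 := Int.lt_floor_add_one s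
  have h3 : (0:ℝ) ≤ (⌊s⌋ : ℝ) := by exact_mod_cast Int.floor_nonneg.mpr hs0
  set m : ℝ := (⌊s⌋ : ℝ) with hm
  have hp : 0 < 2 * m + 1 := by linarith
  have e : (x + m * (1 + m)) / (2 * m + 1) - s = ((s - m) ^ 2 - (s - m)) / (2 * m + 1) := by
    rw [← hs]; field_simp; ring
  rw [e, abs_div, abs_of_pos hp, div_le_div_iff₀ hp (by positivity)]
  have h4 : |(s - m) ^ 2 - (s - m)| ≤ 1 / 4 := by
    rw [abs_le]; constructor <;> nlinarith [sq_nonneg (s - m - 1 / 2)]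
  nlinarith

/-- Majorant of `1/(2m+1)` as function of `j = N - n`. -/
noncomputable def wgt (N : ℝ) (j : ℕ) : ℝ :=
  if j = 0 then 1 else 1 / (Real.sqrt j * Real.sqrt N)

lemma wgt_nonneg (N : ℝ) (j : ℕ) : 0 ≤ wgt N j := by
  unfold wgt; split_ifs <;> positivity

lemma sum_wgt_le (N : ℝ) (hN : 0 < N) (k : ℕ) :
    ∑ j ∈ Finset.range k, wgt N j ≤ 1 + 4 * Real.sqrt k / Real.sqrt N := by
  induction k with
  | zero => simp
  | succ k ih =>
    rw [Finset.sum_range_succ]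
    rcases Nat.eq_zero_or_pos k with rfl | hk
    · simp [wgt]; positivity
    · have hk' : (1:ℝ) ≤ k := by exact_mod_cast hk
      have hw : wgt N k = (1 / Real.sqrt k) / Real.sqrt N := by
        rw [wgt, if_neg hk.ne', div_div]
      have hsN : 0 < Real.sqrt N := Real.sqrt_pos.mpr hN
      have key : 1 / Real.sqrt k ≤ 4 * Real.sqrt ((k + 1 : ℕ) : ℝ) - 4 * Real.sqrt k := by
        push_cast
        have a1 : Real.sqrt k ^ 2 = k := Real.sq_sqrt (by linarith)
        have a2 : Real.sqrt ((k:ℝ) + 1) ^ 2 = k + 1 := Real.sq_sqrt (by linarith)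
        have a3 : 0 < Real.sqrt k := Real.sqrt_pos.mpr (by linarith)
        have a4 : 0 < Real.sqrt ((k:ℝ) + 1) := Real.sqrt_pos.mpr (by linarith)
        have a5 : Real.sqrt ((k:ℝ) + 1) ≤ 3 * Real.sqrt k := by
          apply Real.sqrt_le_iff.mpr
          constructor
          · positivity
          · nlinarith
        set a := Real.sqrt k
        set b := Real.sqrt ((k:ℝ) + 1)
        have : 4 * b - 4 * a = 4 / (b + a) := by
          rw [eq_div_iff (by positivity)]; nlinarith
        rw [this, div_le_div_iff₀ a3 (by positivity)]
        linarith
      rw [hw]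
      have : (1 / Real.sqrt k) / Real.sqrt N ≤
          4 * Real.sqrt ((k + 1 : ℕ) : ℝ) / Real.sqrt N - 4 * Real.sqrt k / Real.sqrt N := by
        rw [← sub_div]; gcongr
      linarith

/-- There are `C > 0`, `α₀ > 0` such that for all `α ≥ α₀`,
`|Σ_{n=v₁+1}^{v_k} (P⁻¹(α−n²)/(4n²−1) − √(α−n²)/(4n²))| ≤ C/α`, where
`v₁ = ⌊√(α/2)⌋` and `v_k = ⌊√α⌋`. -/
theorem sum_sqrt_estimate :
    ∃ C > (0:ℝ), ∃ α₀ > (0:ℝ), ∀ α : ℝ, α₀ ≤ α →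
      |∑ n ∈ Finset.Icc (⌊Real.sqrt (α / 2)⌋ + 1) ⌊Real.sqrt α⌋,
          (Pinv (α - (n : ℝ)^2) / (4 * (n : ℝ)^2 - 1) -
           Real.sqrt (α - (n : ℝ)^2) / (4 * (n : ℝ)^2))| ≤ C / α := by
  refine ⟨2, by norm_num, 1, by norm_num, fun α hα => ?_⟩
  have hα0 : 0 < α := by linarith
  have hr : Real.sqrt α ^ 2 = α := Real.sq_sqrt hα0.le
  have hr1 : 1 ≤ Real.sqrt α := Real.one_le_sqrt.mpr hα
  have hh : Real.sqrt (α / 2) ^ 2 = α / 2 := Real.sq_sqrt (by linarith)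
  have hh0 := Real.sqrt_nonneg (α / 2)
  obtain ⟨N, hN⟩ : ∃ N : ℕ, ⌊Real.sqrt α⌋ = (N : ℤ) :=
    ⟨_, (Int.toNat_of_nonneg (Int.floor_nonneg.mpr (by linarith))).symm⟩
  have hNle : (N : ℝ) ≤ Real.sqrt α := by
    have := Int.floor_le (Real.sqrt α); rw [hN] at this; exact_mod_cast this
  have hN1 : 1 ≤ N := by
    have : (1:ℤ) ≤ ⌊Real.sqrt α⌋ := Int.le_floor.mpr (by exact_mod_cast hr1)
    omega
  have hN1' : (1:ℝ) ≤ N := by exact_mod_cast hN1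
  have hfl : (0:ℤ) ≤ ⌊Real.sqrt (α / 2)⌋ := Int.floor_nonneg.mpr hh0
  rw [hN]
  set F : ℕ → ℝ := fun j => 1 / (4 * α) * wgt N j + 1 / (2 * α * Real.sqrt α) with hF
  have hF0 : ∀ j, 0 ≤ F j := fun j => by
    have := wgt_nonneg N j
    simp only [hF]; positivity
  have term : ∀ n ∈ Finset.Icc (⌊Real.sqrt (α / 2)⌋ + 1) (N : ℤ),
      |Pinv (α - (n : ℝ)^2) / (4 * (n : ℝ)^2 - 1) -
           Real.sqrt (α - (n : ℝ)^2) / (4 * (n : ℝ)^2)| ≤ F ((N : ℤ) - n).toNat := by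
    intro n hn
    rw [Finset.mem_Icc] at hn
    obtain ⟨hn1, hn2⟩ := hn
    obtain ⟨j, hj⟩ : ∃ j : ℕ, (N : ℤ) - n = j := ⟨_, (Int.toNat_of_nonneg (by omega)).symm⟩
    rw [hj, Int.toNat_natCast]
    have hjr : (N : ℝ) - n = j := by exact_mod_cast hj
    have hnl : Real.sqrt (α / 2) < n := by
      have h1 := Int.lt_floor_add_one (Real.sqrt (α / 2))
      have h2 : ((⌊Real.sqrt (α / 2)⌋ : ℝ)) + 1 ≤ n := by exact_mod_cast hn1
      linarith
    have hnN : (n : ℝ) ≤ N := by exact_mod_cast hn2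
    have hn0 : (0:ℝ) < n := by linarith
    have hnsq : α / 2 ≤ (n:ℝ)^2 := by nlinarith
    have hx : (j:ℝ) * N ≤ α - (n:ℝ)^2 := by rw [← hjr]; nlinarith
    have hx0 : 0 ≤ α - (n:ℝ)^2 := le_trans (by positivity) hx
    have hxa : α - (n:ℝ)^2 ≤ α := by nlinarith
    have hP := Pinv_sub_sqrt_le _ hx0
    have hs1 : Real.sqrt (α - (n:ℝ)^2) ≤ Real.sqrt α := Real.sqrt_le_sqrt hxa
    have hs2 : Real.sqrt j * Real.sqrt N ≤ Real.sqrt (α - (n:ℝ)^2) := by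
      rw [← Real.sqrt_mul (by positivity)]; exact Real.sqrt_le_sqrt hx
    have hs0 := Real.sqrt_nonneg (α - (n:ℝ)^2)
    generalize hp : Pinv (α - (n:ℝ)^2) = p at hP ⊢
    set s := Real.sqrt (α - (n:ℝ)^2) with hs
    have h2 : s < (⌊s⌋ : ℝ) + 1 := Int.lt_floor_add_one s
    have h3 : (0:ℝ) ≤ (⌊s⌋ : ℝ) := by exact_mod_cast Int.floor_nonneg.mpr hs0
    have hw : 1 / (2 * (⌊s⌋ : ℝ) + 1) ≤ wgt N j := by
      unfold wgt
      split_ifs with h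
      · rw [div_le_one (by positivity)]; linarith
      · have : 0 < Real.sqrt j * Real.sqrt N := by
          have : (0:ℝ) < j := by exact_mod_cast Nat.pos_of_ne_zero h
          positivity
        apply one_div_le_one_div_of_le this
        linarith
    have hP' : |p - s| ≤ 1 / 4 * wgt N j := by
      refine hP.trans ?_
      rw [← one_div_mul_one_div]; gcongr
    have hd : α ≤ 4 * (n:ℝ)^2 - 1 := by linarith
    have hd0 : 0 < 4 * (n:ℝ)^2 - 1 := by linarith
    have e : p / (4 * (n : ℝ)^2 - 1) - s / (4 * (n : ℝ)^2) =
        (p - s) / (4 * (n : ℝ)^2 - 1) + s / ((4 * (n : ℝ)^2) * (4 * (n : ℝ)^2 - 1)) := by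
      field_simp; ring
    rw [e]
    refine (abs_add_le _ _).trans ?_
    simp only [hF]
    apply add_le_add
    · rw [abs_div, abs_of_pos hd0]
      calc |p - s| / (4 * (n : ℝ)^2 - 1) ≤ (1 / 4 * wgt N j) / α := by
            have := wgt_nonneg N j
            gcongr
        _ = _ := by field_simp
    · rw [abs_of_nonneg (by positivity)]
      calc s / ((4 * (n : ℝ)^2) * (4 * (n : ℝ)^2 - 1)) ≤ Real.sqrt α / ((2 * α) * α) := by
            have h24 : 2 * α ≤ 4 * (n : ℝ)^2 := by linarith
            exact div_le_div₀ (by positivity) hs1 (by positivity)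
              (mul_le_mul h24 hd hα0.le (by positivity))
        _ = Real.sqrt α / ((2 * α) * Real.sqrt α ^ 2) := by rw [hr]
        _ = _ := by field_simp
  refine (Finset.abs_sum_le_sum_abs _ _).trans ?_
  refine (Finset.sum_le_sum term).trans ?_
  have hsum : ∑ n ∈ Finset.Icc (⌊Real.sqrt (α / 2)⌋ + 1) (N : ℤ), F ((N : ℤ) - n).toNat ≤
      ∑ j ∈ Finset.range N, F j := by
    rw [← Finset.sum_image (f := F) (g := fun n : ℤ => ((N : ℤ) - n).toNat)]
    · apply Finset.sum_le_sum_of_subset_of_nonneg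
      · intro j hj
        simp only [Finset.mem_image, Finset.mem_Icc] at hj
        obtain ⟨n, hn, rfl⟩ := hj
        rw [Finset.mem_range]; omega
      · intro j _ _; exact hF0 j
    · intro a ha b hb hab
      simp only [Finset.coe_Icc, Set.mem_Icc] at ha hb
      simp only at hab
      omega
  refine hsum.trans ?_
  simp only [hF]
  rw [Finset.sum_add_distrib, ← Finset.mul_sum, Finset.sum_const, Finset.card_range, nsmul_eq_mul]
  have hW := sum_wgt_le N (by linarith) N
  have hsN : 0 < Real.sqrt N := Real.sqrt_pos.mpr (by linarith)
  rw [mul_div_assoc, div_self hsN.ne'] at hW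
  calc 1 / (4 * α) * ∑ j ∈ Finset.range N, wgt N j + N * (1 / (2 * α * Real.sqrt α))
      ≤ 1 / (4 * α) * (1 + 4 * 1) + Real.sqrt α * (1 / (2 * α * Real.sqrt α)) := by gcongr
    _ = (7 / 4) / α := by field_simp; norm_num
    _ ≤ 2 / α := by gcongr; norm_num
end

section
/- There exist constants C > 0 and α₀ > 0 such that for all α ≥ α₀, | ∫_{v₁+1/2}^{v_k−1/2} √(α − x²)/x² dx − ( 1 − π/4 + (2a−1)/√(2α) − (1/3)(2b+1)^{3/2}/α^{3/4} ) | ≤ C/α, where v₁ = ⌊√(α/2)⌋, v_k = ⌊√α⌋, a = √(α/2) − v₁ and b = √α − v_k are the fractional parts of √(α/2) and √α. -/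
open Filter Topology intervalIntegral

/-- The rescaled integrand. -/
noncomputable def ieF (t : ℝ) : ℝ := Real.sqrt (1 - t ^ 2) / t ^ 2

lemma ieF_contOn (a b : ℝ) (ha : 0 < a) (hb : 0 < b) : ContinuousOn ieF (Set.uIcc a b) := by
  unfold ieF
  apply ContinuousOn.div
  · fun_prop
  · fun_prop
  · intro x hx
    have : 0 < x := lt_of_lt_of_le (lt_min ha hb) hx.1
    positivity

lemma ieF_int (a b : ℝ) (ha : 0 < a) (hb : 0 < b) :
    IntervalIntegrable ieF MeasureTheory.volume a b :=
  (ieF_contOn a b ha hb).intervalIntegrable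

lemma ie_main (c : ℝ) (hc : 0 < c) (hc2 : c ^ 2 = 1 / 2) :
    ∫ t in c..1, ieF t = 1 - Real.pi / 4 := by
  have hc1 : c ≤ 1 := by nlinarith
  have key := intervalIntegral.integral_eq_sub_of_hasDerivAt_of_le (f' := ieF)
    (f := fun t => -(Real.sqrt (1 - t ^ 2) / t) - Real.arcsin t) hc1 ?_ ?_ (ieF_int c 1 hc one_pos)
  · rw [key]
    have h1 : Real.sqrt (1 - c ^ 2) = c := by
      rw [show 1 - c ^ 2 = c ^ 2 by linarith]; exact Real.sqrt_sq hc.le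
    have h2 : Real.arcsin c = Real.pi / 4 := by
      have h3 : c = Real.sin (Real.pi / 4) := by
        rw [Real.sin_pi_div_four]
        have h4 : (Real.sqrt 2 / 2) ^ 2 = 1 / 2 := by
          rw [div_pow, Real.sq_sqrt (by norm_num)]; norm_num
        have h5 : 0 < Real.sqrt 2 / 2 := by positivity
        nlinarith
      rw [h3]
      apply Real.arcsin_sin <;> linarith [Real.pi_pos]
    simp only [h1, h2, Real.arcsin_one]
    rw [div_self hc.ne']
    norm_num
    ring
  · apply ContinuousOn.sub
    · apply ContinuousOn.neg
      apply ContinuousOn.div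
      · fun_prop
      · fun_prop
      · intro x hx
        have : 0 < x := lt_of_lt_of_le hc hx.1
        positivity
    · exact Real.continuous_arcsin.continuousOn
  · intro t ht
    have h0 : 0 < t := hc.trans ht.1
    have h1 : t < 1 := ht.2
    have hp : 0 < 1 - t ^ 2 := by nlinarith
    have hs : 0 < Real.sqrt (1 - t ^ 2) := Real.sqrt_pos.2 hp
    have hsq : Real.sqrt (1 - t ^ 2) ^ 2 = 1 - t ^ 2 := Real.sq_sqrt hp.le
    have d1 : HasDerivAt (fun t : ℝ => 1 - t ^ 2) (-(2 * t)) t := by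
      simpa using ((hasDerivAt_id t).pow 2).const_sub 1
    have d2 := ((d1.sqrt hp.ne').div (hasDerivAt_id t) h0.ne').neg.sub
      (Real.hasDerivAt_arcsin (by linarith) h1.ne)
    refine HasDerivAt.congr_deriv (f := fun t => -(Real.sqrt (1 - t ^ 2) / t) - Real.arcsin t) d2 ?_
    unfold ieF
    simp only [id]
    field_simp
    rw [hsq]
    ring

lemma ie_lower (c h : ℝ) (hc : 0 < c) (hc2 : c ^ 2 = 1 / 2) (hh : |h| ≤ 1 / 20) :
    |(∫ t in (c - h)..c, ieF t) - 2 * c * h| ≤ 20 * h ^ 2 := by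
  have hc7 : 0.7 < c := by nlinarith
  have hc8 : c < 0.72 := by nlinarith
  obtain ⟨hh1, hh2⟩ := abs_le.1 hh
  have e : (∫ t in (c - h)..c, ieF t) - 2 * c * h = ∫ t in (c - h)..c, (ieF t - 2 * c) := by
    rw [intervalIntegral.integral_sub (ieF_int _ _ (by linarith) hc) (by simp)]
    simp
    ring
  rw [e]
  have := intervalIntegral.norm_integral_le_of_norm_le_const (a := c - h) (b := c)
    (f := fun t => ieF t - 2 * c) (C := 20 * |h|) ?_
  · rw [Real.norm_eq_abs] at this
    refine this.trans (le_of_eq ?_)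
    rw [show c - (c - h) = h by ring, mul_assoc, abs_mul_abs_self]; ring
  · intro t ht
    have ht' := Set.uIoc_subset_uIcc ht
    have hct : |c - t| ≤ |h| := by
      have := Set.abs_sub_right_of_mem_uIcc ht'
      simpa using this
    have hct2 := abs_le.1 (hct.trans hh)
    have t1 : 0.6 < t := by linarith
    have t2 : t < 0.8 := by linarith
    have hp : 0 < 1 - t ^ 2 := by nlinarith
    have hsq : Real.sqrt (1 - t ^ 2) ^ 2 = 1 - t ^ 2 := Real.sq_sqrt hp.le
    have hr := Real.sqrt_nonneg (1 - t ^ 2)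
    unfold ieF
    set r := Real.sqrt (1 - t ^ 2)
    have hrc : 0 < r + c := by linarith
    have e2 : r / t ^ 2 - 2 * c = (c - t) * ((c + t) * (1 / (r + c) + 2 * c) / t ^ 2) := by
      field_simp
      have : r ^ 2 - c ^ 2 = c ^ 2 - t ^ 2 := by linarith
      have h3 : 2 * c * c ^ 2 = c := by rw [hc2]; ring
      linear_combination this - (r + c) * h3
    rw [e2, Real.norm_eq_abs, abs_mul, mul_comm]
    have b1 : 1 / (r + c) ≤ 1.5 := by
      rw [div_le_iff₀ hrc]; linarith
    have b0 : 0 ≤ 1 / (r + c) := by positivity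
    have b2 : (c + t) * (1 / (r + c) + 2 * c) ≤ 1.52 * 3 := by
      apply mul_le_mul <;> linarith
    have : |(c + t) * (1 / (r + c) + 2 * c) / t ^ 2| ≤ 20 := by
      rw [abs_of_nonneg (by positivity), div_le_iff₀ (by positivity)]
      nlinarith
    exact mul_le_mul this hct (abs_nonneg _) (by norm_num)

lemma ie_sqrt_int (d : ℝ) (hd : 0 ≤ d) :
    ∫ t in (1 - d)..1, Real.sqrt 2 * Real.sqrt (1 - t) = (1 / 3) * (2 * d) ^ ((3:ℝ)/2) := by
  rw [intervalIntegral.integral_const_mul,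
    intervalIntegral.integral_comp_sub_left (fun u => Real.sqrt u) 1]
  simp only [sub_self, sub_sub_cancel, Real.sqrt_eq_rpow]
  rw [integral_rpow (Or.inl (by norm_num)), Real.mul_rpow (by norm_num) hd]
  rw [Real.zero_rpow (by norm_num)]
  have : (2:ℝ) ^ ((3:ℝ)/2) = 2 * 2 ^ ((1:ℝ)/2) := by
    rw [show (3:ℝ)/2 = 1 + 1/2 by norm_num, Real.rpow_add (by norm_num), Real.rpow_one]
  rw [this, show (1:ℝ)/2 + 1 = 3/2 by norm_num]
  ring

lemma ie_upper (d : ℝ) (hd : 0 ≤ d) (hd2 : d ≤ 1 / 2) :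
    |(∫ t in (1 - d)..1, ieF t) - (1 / 3) * (2 * d) ^ ((3:ℝ)/2)| ≤ 12 * d ^ 2 := by
  rw [← ie_sqrt_int d hd, ← intervalIntegral.integral_sub (ieF_int _ _ (by linarith) one_pos)
    (Continuous.intervalIntegrable (by fun_prop) _ _)]
  have := intervalIntegral.norm_integral_le_of_norm_le_const (a := 1 - d) (b := 1)
    (f := fun t => ieF t - Real.sqrt 2 * Real.sqrt (1 - t)) (C := 12 * d) ?_
  · rw [Real.norm_eq_abs] at this
    refine this.trans (le_of_eq ?_)
    rw [sub_sub_cancel, abs_of_nonneg hd]; ring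
  · intro t ht
    rw [Set.uIoc_of_le (by linarith)] at ht
    obtain ⟨h1, h2⟩ := ht
    have t1 : 1 / 2 < t := by linarith
    unfold ieF
    have e : Real.sqrt (1 - t ^ 2) / t ^ 2 - Real.sqrt 2 * Real.sqrt (1 - t)
        = Real.sqrt (1 - t) * (Real.sqrt (1 + t) / t ^ 2 - Real.sqrt 2) := by
      rw [show 1 - t ^ 2 = (1 - t) * (1 + t) by ring, Real.sqrt_mul (by linarith)]
      ring
    have s1 : Real.sqrt (1 - t) ≤ 1 := Real.sqrt_le_one.2 (by linarith)
    have s2 : Real.sqrt (1 + t) ≤ Real.sqrt 2 := Real.sqrt_le_sqrt (by linarith)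
    have s3 : Real.sqrt 2 ≤ 1.5 := by
      rw [Real.sqrt_le_left (by norm_num)]; norm_num
    have s4 : Real.sqrt 2 * t ^ 2 ≤ Real.sqrt (1 + t) := by
      apply Real.le_sqrt_of_sq_le
      rw [mul_pow, Real.sq_sqrt (by norm_num)]
      have : t ^ 2 ≤ t := by nlinarith
      have : (t ^ 2) ^ 2 ≤ t ^ 2 := by nlinarith
      linarith
    have tp : 0 < t ^ 2 := by positivity
    have g0 : 0 ≤ Real.sqrt (1 + t) / t ^ 2 - Real.sqrt 2 := by
      rw [sub_nonneg, le_div_iff₀ tp]; exact s4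
    have g1 : Real.sqrt (1 + t) / t ^ 2 - Real.sqrt 2 ≤ 12 * d := by
      rw [sub_le_iff_le_add, div_le_iff₀ tp]
      have a1 : Real.sqrt 2 * (1 - t ^ 2) ≤ 1.5 * (1 - t ^ 2) :=
        mul_le_mul_of_nonneg_right s3 (by nlinarith)
      have a2 : 12 * d * (1/4) ≤ 12 * d * t ^ 2 :=
        mul_le_mul_of_nonneg_left (by nlinarith) (by linarith)
      nlinarith
    rw [e, Real.norm_eq_abs, abs_of_nonneg (mul_nonneg (Real.sqrt_nonneg _) g0)]
    calc _ ≤ 1 * (12 * d) := mul_le_mul s1 g1 g0 (by norm_num)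
      _ = _ := one_mul _

lemma ie_scale (s p q : ℝ) (hs : 0 < s) :
    ∫ x in p..q, Real.sqrt (s ^ 2 - x ^ 2) / x ^ 2 = ∫ t in (p / s)..(q / s), ieF t := by
  have h := intervalIntegral.mul_integral_comp_mul_left (a := p / s) (b := q / s)
    (f := fun x => Real.sqrt (s ^ 2 - x ^ 2) / x ^ 2) (c := s)
  rw [mul_div_cancel₀ _ hs.ne', mul_div_cancel₀ _ hs.ne'] at h
  rw [← h, ← intervalIntegral.integral_const_mul]
  congr 1
  ext t
  unfold ieF
  rw [show s ^ 2 - (s * t) ^ 2 = s ^ 2 * (1 - t ^ 2) by ring, Real.sqrt_mul (by positivity),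
    Real.sqrt_sq hs.le]
  field_simp

/-- There are `C > 0`, `α₀ > 0` such that for all `α ≥ α₀`, the integral
`∫_{v₁+1/2}^{v_k−1/2} √(α−x²)/x² dx` differs from
`1 − π/4 + (2a−1)/√(2α) − (1/3)(2b+1)^{3/2}/α^{3/4}` by at most `C/α`, where
`v₁ = ⌊√(α/2)⌋`, `v_k = ⌊√α⌋`, and `a`, `b` are the fractional parts of
`√(α/2)` and `√α` respectively. -/
theorem integral_estimate :
    ∃ C > (0:ℝ), ∃ α₀ > (0:ℝ), ∀ α : ℝ, α₀ ≤ α →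
      |(∫ x in ((⌊Real.sqrt (α / 2)⌋ : ℝ) + 1/2)..((⌊Real.sqrt α⌋ : ℝ) - 1/2),
            Real.sqrt (α - x^2) / x^2) -
        (1 - Real.pi / 4 +
          (2 * Int.fract (Real.sqrt (α / 2)) - 1) / Real.sqrt (2 * α) -
          (1/3) * (2 * Int.fract (Real.sqrt α) + 1) ^ ((3:ℝ)/2) / α ^ ((3:ℝ)/4))|
        ≤ C / α := by
  refine ⟨32, by norm_num, 100, by norm_num, fun α hα => ?_⟩
  obtain ⟨s, hs⟩ : ∃ s, s = Real.sqrt α := ⟨_, rfl⟩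
  have hs10 : 10 ≤ s := by
    rw [hs]; apply Real.le_sqrt_of_sq_le; linarith
  have hs0 : 0 < s := by linarith
  have hsq : α = s ^ 2 := by rw [hs, Real.sq_sqrt (by linarith)]
  obtain ⟨c, hcd⟩ : ∃ c, c = Real.sqrt (1 / 2) := ⟨_, rfl⟩
  have hc : 0 < c := by rw [hcd]; positivity
  have hc2 : c ^ 2 = 1 / 2 := by rw [hcd, Real.sq_sqrt (by norm_num)]
  have r1 : Real.sqrt (α / 2) = c * s := by
    rw [hsq, show s ^ 2 / 2 = (c * s) ^ 2 by rw [mul_pow, hc2]; ring]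
    exact Real.sqrt_sq (by positivity)
  have r2 : Real.sqrt (2 * α) = 2 * c * s := by
    rw [hsq, show 2 * s ^ 2 = (2 * c * s) ^ 2 by rw [mul_pow, mul_pow, hc2]; ring]
    exact Real.sqrt_sq (by positivity)
  have r3 : α ^ ((3:ℝ)/4) = s ^ ((3:ℝ)/2) := by
    rw [hsq, ← Real.rpow_natCast, ← Real.rpow_mul hs0.le]; norm_num
  rw [r1, r2, r3, ← hs]
  have fa0 := Int.fract_nonneg (c * s)
  have fa1 := Int.fract_lt_one (c * s)
  have fb0 := Int.fract_nonneg s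
  have fb1 := Int.fract_lt_one s
  have fa := Int.floor_add_fract (c * s)
  have fb := Int.floor_add_fract s
  set a := Int.fract (c * s)
  set b := Int.fract s
  obtain ⟨h, hh⟩ : ∃ h, h = (a - 1 / 2) / s := ⟨_, rfl⟩
  obtain ⟨d, hd⟩ : ∃ d, d = (b + 1 / 2) / s := ⟨_, rfl⟩
  rw [hsq, ie_scale s _ _ hs0]
  have e1 : ((⌊c * s⌋ : ℝ) + 1 / 2) / s = c - h := by
    rw [hh, show (⌊c * s⌋ : ℝ) = c * s - a by linarith]; field_simp; ring
  have e2 : ((⌊s⌋ : ℝ) - 1 / 2) / s = 1 - d := by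
    rw [hd, show (⌊s⌋ : ℝ) = s - b by linarith]; field_simp; ring
  rw [e1, e2]
  have e3 : (2 * a - 1) / (2 * c * s) = 2 * c * h := by
    rw [hh]; field_simp; rw [hc2]; ring
  have e4 : (1/3) * (2 * b + 1) ^ ((3:ℝ)/2) / s ^ ((3:ℝ)/2) = (1 / 3) * (2 * d) ^ ((3:ℝ)/2) := by
    rw [mul_div_assoc, ← Real.div_rpow (by linarith) hs0.le, hd]
    congr 2; ring
  rw [e3, e4]
  have hha : |h| ≤ (1 / 2) / s := by
    rw [hh, abs_div, abs_of_pos hs0]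
    gcongr
    rw [abs_le]; constructor <;> linarith
  have hh20 : |h| ≤ 1 / 20 := by
    refine hha.trans ?_
    rw [div_le_iff₀ hs0]; linarith
  have hd0 : 0 ≤ d := by rw [hd]; positivity
  have hd1 : d ≤ (3 / 2) / s := by rw [hd]; gcongr; linarith
  have hd2 : d ≤ 1 / 2 := by
    refine hd1.trans ?_
    rw [div_le_iff₀ hs0]; linarith
  have L := ie_lower c h hc hc2 hh20
  have U := ie_upper d hd0 hd2
  have M := ie_main c hc hc2
  have hc7 : 0.7 < c := by nlinarith
  have hch : 0 < c - h := by linarith [(abs_le.1 hh20).2]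
  have hdd : 0 < 1 - d := by linarith
  have S1 := intervalIntegral.integral_add_adjacent_intervals (ieF_int (c - h) c hch hc)
    (ieF_int c 1 hc one_pos)
  have S2 := intervalIntegral.integral_add_adjacent_intervals (ieF_int (c - h) (1 - d) hch hdd)
    (ieF_int (1 - d) 1 hdd one_pos)
  have hB : h ^ 2 ≤ (1 / 4) / s ^ 2 := by
    rw [← sq_abs]
    calc _ ≤ ((1 / 2) / s) ^ 2 := by gcongr
      _ = _ := by ring
  have dB : d ^ 2 ≤ (9 / 4) / s ^ 2 := by
    calc _ ≤ ((3 / 2) / s) ^ 2 := by gcongr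
      _ = _ := by ring
  have fin : 20 * ((1 / 4) / s ^ 2) + 12 * ((9 / 4) / s ^ 2) = 32 / s ^ 2 := by ring
  rw [abs_le] at L U ⊢
  constructor <;> linarith [L.1, L.2, U.1, U.2]
end

section
/- Fix b ∈ [0,1). For v ∈ ℕ let v₁ = ⌊(v+b)/√2⌋ and define S(v) = v^{3/2} · Σ_{n=v₁+1}^{v−1} ∫_{n−1/2}^{n+1/2} ( √((v+b)² − n²)/n² − √((v+b)² − x²)/x² ) dx. Then the limit ε(b) = lim_{v→∞} S(v) exists, and it satisfies (1/36)·1/√(3(b+1)) ≤ ε(b) ≤ (1/12)·(1/√(b+1))·(2b+3)/(2b+2). -/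
open Filter Topology intervalIntegral

/-- Three samples with size `A` and relative variation `β`. -/
def QB (A β f0 fp fm : ℝ) : Prop :=
  |f0| ≤ A ∧ |fp| ≤ A ∧ |fm| ≤ A ∧ |fp - fm| ≤ A * β ∧ |2 * f0 - fp - fm| ≤ A * β ^ 2

lemma QB.mul {A B β f0 fp fm g0 gp gm : ℝ} (hβ : 0 ≤ β)
    (hf : QB A β f0 fp fm) (hg : QB B β g0 gp gm) :
    QB (3 * (A * B)) β (f0 * g0) (fp * gp) (fm * gm) := by
  obtain ⟨f1, f2, f3, f4, f5⟩ := hf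
  obtain ⟨g1, g2, g3, g4, g5⟩ := hg
  have hA : 0 ≤ A := (abs_nonneg _).trans f1
  have hB : 0 ≤ B := (abs_nonneg _).trans g1
  have hAB := mul_nonneg hA hB
  have key : ∀ {x y X Y : ℝ}, |x| ≤ X → |y| ≤ Y → |x * y| ≤ X * Y := by
    intro x y X Y hx hy
    rw [abs_mul]
    exact mul_le_mul hx hy (abs_nonneg _) ((abs_nonneg _).trans hx)
  refine ⟨?_, ?_, ?_, ?_, ?_⟩
  · linarith [key f1 g1]
  · linarith [key f2 g2]
  · linarith [key f3 g3]
  · have h1 := key f4 g2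
    have h2 := key f3 g4
    have e : fp * gp - fm * gm = (fp - fm) * gp + fm * (gp - gm) := by ring
    rw [e]
    have := abs_add_le ((fp - fm) * gp) (fm * (gp - gm))
    have : 0 ≤ A * B * β := by positivity
    nlinarith
  · have h1 := key f5 g1
    have h0 : |fp + fm| ≤ 2 * A := (abs_add_le _ _).trans (by linarith)
    have h2 := key h0 g5
    have h3 := key f4 g4
    have e : 2 * (f0 * g0) - fp * gp - fm * gm = (2 * f0 - fp - fm) * g0
      + ((fp + fm) * (2 * g0 - gp - gm)) / 2 - ((fp - fm) * (gp - gm)) / 2 := by ring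
    have : 0 ≤ A * B * β ^ 2 := by positivity
    rw [e]
    rw [abs_le] at h1 h2 h3 ⊢
    constructor <;> nlinarith

/-- Second difference of the square root. -/
lemma sqrt_diff {s t : ℝ} (hs : 1 ≤ s) (ht : |t| ≤ 1 / 2) :
    (t ^ 2 / 4) * (1 / (s * √s)) ≤ 2 * √s - √(s + t) - √(s - t) ∧
    2 * √s - √(s + t) - √(s - t) ≤ (2 * t ^ 2 / 3) * (1 / (s * √s)) := by
  rw [abs_le] at ht
  have hp : 0 ≤ s + t := by linarith
  have hm : 0 ≤ s - t := by linarith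
  obtain ⟨a, ha⟩ : ∃ a, a = √s := ⟨_, rfl⟩
  obtain ⟨p, hp'⟩ : ∃ a, a = √(s + t) := ⟨_, rfl⟩
  obtain ⟨m, hm'⟩ : ∃ a, a = √(s - t) := ⟨_, rfl⟩
  have ha2 : a ^ 2 = s := by rw [ha]; exact Real.sq_sqrt (by linarith)
  have hp2 : p ^ 2 = s + t := by rw [hp']; exact Real.sq_sqrt hp
  have hm2 : m ^ 2 = s - t := by rw [hm']; exact Real.sq_sqrt hm
  have hp0 : 0 ≤ p := by rw [hp']; positivity
  have hm0 : 0 ≤ m := by rw [hm']; positivity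
  have ha0 : 0 < a := by rw [ha]; exact Real.sqrt_pos.mpr (by linarith)
  rw [← ha, ← hp', ← hm']
  have hpm : p * m ≤ s := by nlinarith [sq_nonneg (p - m)]
  have hpm0 : 0 ≤ p * m := mul_nonneg hp0 hm0
  have hS1 : a ≤ p + m := by
    apply le_of_sq_le_sq _ (by positivity) <;> nlinarith
  have hS2 : p + m ≤ 2 * a := by
    apply le_of_sq_le_sq _ (by positivity) <;> nlinarith
  have e1 : (2 * a - p - m) * (2 * a + p + m) = 2 * (s - p * m) := by nlinarith
  have e2 : (s - p * m) * (s + p * m) = t ^ 2 := by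
    have : (p * m) ^ 2 = (s + t) * (s - t) := by rw [mul_pow, hp2, hm2]
    nlinarith
  have e3 : (2 * a - p - m) * ((2 * a + p + m) * (s + p * m)) = 2 * t ^ 2 := by
    rw [← mul_assoc, e1, ← e2]; ring
  have d0 : 0 ≤ 2 * a - p - m := by linarith
  have hsa : 0 < s * a := by positivity
  have u1 : (2 * a + p + m) * (s + p * m) ≤ 8 * (s * a) := by
    have : (2 * a + p + m) * (s + p * m) ≤ (4 * a) * (2 * s) := by
      apply mul_le_mul <;> first | positivity | linarith
    linarith
  have u2 : 3 * (s * a) ≤ (2 * a + p + m) * (s + p * m) := by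
    have : (3 * a) * s ≤ (2 * a + p + m) * (s + p * m) := by
      apply mul_le_mul <;> first | positivity | linarith
    linarith
  have v1 := mul_le_mul_of_nonneg_left u1 d0
  have v2 := mul_le_mul_of_nonneg_left u2 d0
  rw [e3] at v1 v2
  constructor
  · rw [mul_one_div, div_le_iff₀ hsa]; linarith
  · rw [mul_one_div, le_div_iff₀ hsa]; linarith

lemma QB_sqrt {s t β : ℝ} (hs : 1 ≤ s) (ht : |t| ≤ 1 / 2) (hβ : 1 / s ≤ β) :
    QB (2 * √s) β (√s) (√(s + t)) (√(s - t)) := by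
  obtain ⟨l, u⟩ := sqrt_diff hs ht
  have ht' := ht
  rw [abs_le] at ht
  have hs0 : 0 < s := by linarith
  have q : 0 < √s := Real.sqrt_pos.mpr hs0
  have hb0 : 0 < 1 / s := by positivity
  have up : ∀ y, y ≤ 4 * s → √y ≤ 2 * √s := by
    intro y hy
    rw [Real.sqrt_le_left (by positivity), mul_pow, Real.sq_sqrt hs0.le]; linarith
  have hss : √s * √s = s := Real.mul_self_sqrt hs0.le
  have t2 : t ^ 2 ≤ 1 / 4 := by nlinarith
  refine ⟨?_, ?_, ?_, ?_, ?_⟩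
  · rw [abs_of_nonneg (by positivity)]; linarith
  · rw [abs_of_nonneg (by positivity)]; exact up _ (by linarith)
  · rw [abs_of_nonneg (by positivity)]; exact up _ (by linarith)
  · have hp0 : 0 ≤ √(s + t) := by positivity
    have hm0 : 0 ≤ √(s - t) := by positivity
    have hp2 : √(s + t) ^ 2 = s + t := Real.sq_sqrt (by linarith)
    have hm2 : √(s - t) ^ 2 = s - t := Real.sq_sqrt (by linarith)
    have hS1 : √s ≤ √(s + t) + √(s - t) := by
      apply le_of_sq_le_sq _ (by positivity)
      rw [Real.sq_sqrt hs0.le]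
      nlinarith [mul_nonneg hp0 hm0]
    have e : |√(s + t) - √(s - t)| * (√(s + t) + √(s - t)) = |2 * t| := by
      have e' : √(s + t) + √(s - t) = |√(s + t) + √(s - t)| :=
        (abs_of_nonneg (add_nonneg hp0 hm0)).symm
      rw [e', ← abs_mul]; congr 1; nlinarith
    have : |2 * t| ≤ 1 := by rw [abs_mul, abs_two]; linarith
    have h1 : |√(s + t) - √(s - t)| * √s ≤ 1 :=
      (mul_le_mul_of_nonneg_left hS1 (abs_nonneg _)).trans (by linarith)
    have h2 : |√(s + t) - √(s - t)| ≤ √s * (1 / s) := by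
      rw [← le_div_iff₀ q] at h1
      refine h1.trans (le_of_eq ?_)
      field_simp
      nlinarith
    have := mul_le_mul_of_nonneg_left hβ q.le
    have : 0 ≤ √s * (1 / s) := by positivity
    linarith
  · have l0 : 0 ≤ 2 * √s - √(s + t) - √(s - t) := le_trans (by positivity) l
    rw [abs_of_nonneg l0]
    have e : 1 / (s * √s) = √s * (1 / s) ^ 2 := by
      field_simp
      nlinarith
    have h1 : (1 / s) ^ 2 ≤ β ^ 2 := by gcongr
    have h2 := mul_le_mul_of_nonneg_left h1 q.le
    rw [e] at u
    have : 0 ≤ √s * (1 / s) ^ 2 := by positivity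
    nlinarith

lemma QB_inv {s t β : ℝ} (hs : 1 ≤ s) (ht : |t| ≤ 1 / 2) (hβ : 1 / s ≤ β) :
    QB (2 * (1 / s)) β (1 / s) (1 / (s + t)) (1 / (s - t)) := by
  rw [abs_le] at ht
  have hs0 : 0 < s := by linarith
  have hp : 0 < s + t := by linarith
  have hm : 0 < s - t := by linarith
  have hb0 : 0 < 1 / s := by positivity
  have t2 : t ^ 2 ≤ 1 / 4 := by nlinarith
  have hd : (3 / 4) * s ^ 2 ≤ (s + t) * (s - t) := by nlinarith
  refine ⟨?_, ?_, ?_, ?_, ?_⟩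
  · rw [abs_of_nonneg (by positivity)]; linarith
  · rw [abs_of_nonneg (by positivity), mul_one_div, div_le_div_iff₀ hp hs0]; linarith
  · rw [abs_of_nonneg (by positivity), mul_one_div, div_le_div_iff₀ hm hs0]; linarith
  · refine le_trans ?_ (mul_le_mul_of_nonneg_left hβ (by positivity))
    have e : 1 / (s + t) - 1 / (s - t) = (-2 * t) / ((s + t) * (s - t)) := by
      field_simp; ring
    rw [e, abs_div, abs_of_pos (mul_pos hp hm), div_le_iff₀ (mul_pos hp hm)]
    have h1 : |-2 * t| ≤ 1 := by rw [abs_le]; constructor <;> linarith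
    have h2 := mul_le_mul_of_nonneg_left hd (show 0 ≤ 2 * (1 / s) * (1 / s) by positivity)
    have h3 : 2 * (1 / s) * (1 / s) * (3 / 4 * s ^ 2) = 3 / 2 := by field_simp; norm_num
    linarith
  · have h1 : (1 / s) ^ 2 ≤ β ^ 2 := by gcongr
    refine le_trans ?_ (mul_le_mul_of_nonneg_left h1 (by positivity))
    have e : 2 * (1 / s) - 1 / (s + t) - 1 / (s - t)
        = (1 / s) * ((-2 * t ^ 2) / ((s + t) * (s - t))) := by
      field_simp; ring
    rw [e, abs_mul, abs_of_pos hb0, mul_comm 2 (1 / s), mul_assoc]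
    apply mul_le_mul_of_nonneg_left _ hb0.le
    rw [abs_div, abs_of_pos (mul_pos hp hm), div_le_iff₀ (mul_pos hp hm)]
    have h1 : |-2 * t ^ 2| ≤ 1 := by rw [abs_le]; constructor <;> nlinarith
    have h2 := mul_le_mul_of_nonneg_left hd (show 0 ≤ 2 * (1 / s) ^ 2 by positivity)
    have h3 : 2 * (1 / s) ^ 2 * (3 / 4 * s ^ 2) = 3 / 2 := by field_simp; norm_num
    linarith

/-- The function in the sum. -/
noncomputable def FF (w x : ℝ) : ℝ := √(w ^ 2 - x ^ 2) / x ^ 2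

lemma FF_eq {w x : ℝ} (h : x ≤ w) : FF w x = (√(w - x) * √(w + x)) * ((1 / x) * (1 / x)) := by
  rw [FF, ← Real.sqrt_mul (by linarith), show w ^ 2 - x ^ 2 = (w - x) * (w + x) by ring]
  field_simp

lemma rpow32 (v : ℝ) (hv : 0 < v) : v ^ ((3:ℝ)/2) = v * √v := by
  rw [show (3:ℝ)/2 = 1 + 1/2 by norm_num, Real.rpow_add hv, Real.rpow_one, Real.sqrt_eq_rpow]

lemma FF_bound {b v k t : ℝ} (hb0 : 0 ≤ b) (hb1 : b < 1) (hk : 1 ≤ k) (hv : 2 * k ≤ v)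
    (ht : |t| ≤ 1 / 2) :
    |v ^ ((3:ℝ)/2) * (2 * FF (v + b) (v - k) - FF (v + b) (v - k + t) - FF (v + b) (v - k - t))|
      ≤ 5184 * (√k / k ^ 2) := by
  have ht' := ht
  rw [abs_le] at ht'
  have hk0 : 0 < k := by linarith
  have hv0 : 0 < v := by linarith
  have h1 := QB_sqrt (s := k + b) (t := -t) (β := 1 / k) (by linarith) (by rwa [abs_neg])
    (by apply one_div_le_one_div_of_le <;> linarith)
  have h2 := QB_sqrt (s := 2 * v + b - k) (t := t) (β := 1 / k) (by linarith) ht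
    (by apply one_div_le_one_div_of_le <;> linarith)
  have h3 := QB_inv (s := v - k) (t := t) (β := 1 / k) (by linarith) ht
    (by apply one_div_le_one_div_of_le <;> linarith)
  have hβ : 0 ≤ 1 / k := by positivity
  have h := ((h1.mul hβ h2).mul hβ (h3.mul hβ h3)).2.2.2.2
  rw [FF_eq (by linarith), FF_eq (by linarith), FF_eq (by linarith), abs_mul, rpow32 v hv0,
    abs_of_pos (by positivity)]
  have e1 : v + b - (v - k) = k + b := by ring
  have e2 : v + b + (v - k) = 2 * v + b - k := by ring
  have e3 : v + b - (v - k + t) = k + b + -t := by ring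
  have e4 : v + b + (v - k + t) = 2 * v + b - k + t := by ring
  have e5 : v + b - (v - k - t) = k + b - -t := by ring
  have e6 : v + b + (v - k - t) = 2 * v + b - k - t := by ring
  rw [e1, e2, e3, e4, e5, e6]
  refine (mul_le_mul_of_nonneg_left h (by positivity)).trans ?_
  have c1 : √(k + b) * √(2 * v + b - k) ≤ 3 * (√k * √v) := by
    rw [← Real.sqrt_mul (by linarith), ← Real.sqrt_mul hk0.le,
      show (3:ℝ) = √9 by rw [show (9:ℝ) = 3 ^ 2 by norm_num]; simp,
      ← Real.sqrt_mul (by norm_num)]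
    apply Real.sqrt_le_sqrt
    have : (k + b) * (2 * v + b - k) ≤ (2 * k) * (2 * v) := by
      apply mul_le_mul <;> linarith
    nlinarith
  have c2 : 1 / (v - k) ≤ 2 / v := by
    rw [div_le_div_iff₀ (by linarith) hv0]; linarith
  have c20 : 0 ≤ 1 / (v - k) := by
    have : 0 < v - k := by linarith
    positivity
  have c3 : 1 / (v - k) * (1 / (v - k)) ≤ 2 / v * (2 / v) := by
    apply mul_le_mul c2 c2 c20; positivity
  have c4 : √(k + b) * √(2 * v + b - k) * (1 / (v - k) * (1 / (v - k)))
      ≤ 3 * (√k * √v) * (2 / v * (2 / v)) := by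
    apply mul_le_mul c1 c3 (by positivity) (by positivity)
  have hsv : √v * √v = v := Real.mul_self_sqrt hv0.le
  calc _ = (v * √v) * (432 * (√(k + b) * √(2 * v + b - k) * (1 / (v - k) * (1 / (v - k))))
        * (1 / k) ^ 2) := by ring
    _ ≤ (v * √v) * (432 * (3 * (√k * √v) * (2 / v * (2 / v))) * (1 / k) ^ 2) := by gcongr
    _ = 5184 * (√k / k ^ 2) * (v * (√v * √v) / v ^ 2) := by field_simp; norm_num
    _ = _ := by rw [hsv]; field_simp

lemma FF_lim (b u : ℝ) (hu : 0 ≤ b + u) :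
    Tendsto (fun v : ℕ => (v : ℝ) ^ ((3:ℝ)/2) * FF (v + b) (v - u)) atTop
      (𝓝 (√2 * √(b + u))) := by
  have hi : Tendsto (fun v : ℕ => ((v : ℝ))⁻¹) atTop (𝓝 0) := tendsto_inv_atTop_nhds_zero_nat
  have l1 : Tendsto (fun v : ℕ => √(b + u) * √(2 + (b - u) * (v : ℝ)⁻¹) *
      ((1 - u * (v : ℝ)⁻¹)⁻¹) ^ 2) atTop
      (𝓝 (√(b + u) * √(2 + (b - u) * 0) * ((1 - u * 0)⁻¹) ^ 2)) := by
    apply Tendsto.mul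
    · apply Tendsto.mul tendsto_const_nhds
      exact (Real.continuous_sqrt.tendsto _).comp ((hi.const_mul _).const_add _)
    · apply Tendsto.pow
      apply Tendsto.inv₀ _ (by norm_num)
      exact (hi.const_mul _).const_sub _
  have e0 : √(b + u) * √(2 + (b - u) * 0) * ((1 - u * 0)⁻¹) ^ 2 = √2 * √(b + u) := by
    simp [mul_comm]
  rw [e0] at l1
  refine l1.congr' ?_
  filter_upwards [eventually_gt_atTop 0, eventually_gt_atTop ⌈|u| + |b|⌉₊] with v hv hvu
  have hv0 : (0:ℝ) < v := by exact_mod_cast hv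
  have hvu' : |u| + |b| < (v : ℝ) := Nat.lt_of_ceil_lt hvu
  have := le_abs_self u
  have := neg_abs_le b
  have := abs_nonneg b
  have hx : 0 < (v : ℝ) - u := by linarith
  rw [FF_eq (by linarith), rpow32 _ hv0]
  have e1 : 2 + (b - u) * (v : ℝ)⁻¹ = (v + b + (v - u)) / v := by field_simp; ring
  have e2 : (1 - u * (v : ℝ)⁻¹)⁻¹ = v / (v - u) := by
    rw [show 1 - u * (v : ℝ)⁻¹ = (v - u) / v by field_simp, inv_div]
  have e3 : (v : ℝ) + b - (v - u) = b + u := by ring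
  rw [e1, e2, e3, Real.sqrt_div (by linarith)]
  have hq : 0 < √(v : ℝ) := Real.sqrt_pos.mpr hv0
  have hsv : √(v : ℝ) ^ 2 = v := Real.sq_sqrt hv0.le
  field_simp
  rw [hsv]
  ring

/-- Limit integrand. -/
noncomputable def LL (s t : ℝ) : ℝ := √2 * (2 * √s - √(s + t) - √(s - t))

/-- The summands indexed from `v - 1` downward. -/
noncomputable def aa (b : ℝ) (v j : ℕ) : ℝ :=
  ∫ t in (0:ℝ)..(1/2), (v : ℝ) ^ ((3:ℝ)/2) * (2 * FF (v + b) (v - (j + 1))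
    - FF (v + b) (v - (j + 1) + t) - FF (v + b) (v - (j + 1) - t))

lemma FF_cont (w c : ℝ) (hc : 1 ≤ c) : ContinuousOn (fun t => FF w (c + t)) (Set.Icc (-1/2) (1/2)) := by
  unfold FF
  apply ContinuousOn.div
  · fun_prop
  · fun_prop
  · intro t ht
    have := ht.1
    have : 0 < c + t := by linarith
    positivity

lemma aa_eq (b : ℝ) (v j : ℕ) (h : (j : ℝ) + 1 + 1 ≤ v) :
    (v : ℝ) ^ ((3:ℝ)/2) * ∫ x in (((v:ℝ) - (j + 1)) - 1/2)..(((v:ℝ) - (j + 1)) + 1/2),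
      (FF (v + b) (v - (j + 1)) - FF (v + b) x) = aa b v j := by
  rw [aa, intervalIntegral.integral_const_mul]
  congr 1
  set c : ℝ := (v:ℝ) - (j + 1) with hc
  have hc1 : 1 ≤ c := by rw [hc]; linarith
  set w : ℝ := v + b
  have hF := FF_cont w c hc1
  have e1 : ∫ x in (c - 1/2)..(c + 1/2), (FF w c - FF w x)
      = ∫ t in (-1/2:ℝ)..(1/2), (FF w c - FF w (c + t)) := by
    rw [intervalIntegral.integral_comp_add_left (fun x => FF w c - FF w x)]
    congr 1; ring
  have hI : ∀ a d : ℝ, a ∈ Set.Icc (-1/2:ℝ) (1/2) → d ∈ Set.Icc (-1/2:ℝ) (1/2) →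
      IntervalIntegrable (fun t => FF w c - FF w (c + t)) MeasureTheory.volume a d := by
    intro a d ha hd
    apply ContinuousOn.intervalIntegrable
    apply (continuousOn_const.sub hF).mono
    exact (Set.ordConnected_Icc).uIcc_subset ha hd
  have m0 : (0:ℝ) ∈ Set.Icc (-1/2:ℝ) (1/2) := by constructor <;> norm_num
  have m1 : (-1/2:ℝ) ∈ Set.Icc (-1/2:ℝ) (1/2) := by constructor <;> norm_num
  have m2 : (1/2:ℝ) ∈ Set.Icc (-1/2:ℝ) (1/2) := by constructor <;> norm_num
  have e2 : ∫ t in (-1/2:ℝ)..0, (FF w c - FF w (c + t))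
      = ∫ t in (0:ℝ)..(1/2), (FF w c - FF w (c + -t)) := by
    rw [intervalIntegral.integral_comp_neg (fun t => FF w c - FF w (c + t))]
    congr 1 <;> norm_num
  have hI2 : IntervalIntegrable (fun t => FF w c - FF w (c + -t)) MeasureTheory.volume 0 (1/2) := by
    apply ContinuousOn.intervalIntegrable
    apply continuousOn_const.sub
    refine hF.comp continuous_neg.continuousOn ?_
    intro t ht
    rw [Set.uIcc_of_le (by norm_num)] at ht
    constructor <;> linarith [ht.1, ht.2]
  rw [e1, ← intervalIntegral.integral_add_adjacent_intervals (hI _ _ m1 m0) (hI _ _ m0 m2), e2,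
    ← intervalIntegral.integral_add hI2 (hI _ _ m0 m2)]
  apply intervalIntegral.integral_congr
  intro t _
  simp only [← sub_eq_add_neg]
  ring

/-- Index condition. -/
def cond' (b : ℝ) (v j : ℕ) : Prop := ⌊((v : ℝ) + b) / √2⌋ + 1 ≤ (v : ℤ) - (j + 1)

lemma cond_bound {b : ℝ} (hb0 : 0 ≤ b) {v j : ℕ} (h : cond' b v j) :
    2 * ((j : ℝ) + 1) ≤ v := by
  have h1 := Int.lt_floor_add_one (((v : ℝ) + b) / √2)
  have h2 : ((⌊((v : ℝ) + b) / √2⌋ + 1 : ℤ) : ℝ) ≤ (((v : ℤ) - (j + 1) : ℤ) : ℝ) := by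
    exact_mod_cast h
  push_cast at h2
  have h3 : (v : ℝ) / 2 ≤ ((v : ℝ) + b) / √2 := by
    have : √2 ≤ 2 := by rw [Real.sqrt_le_left] <;> norm_num
    gcongr; linarith
  linarith

open Classical in
lemma Ssum_eq {b : ℝ} (hb0 : 0 ≤ b) (v : ℕ) :
    Ssum b v = ∑' j : ℕ, if cond' b v j then aa b v j else 0 := by
  rw [tsum_eq_sum (s := Finset.range v)]
  · rw [← Finset.sum_filter, Ssum, Finset.mul_sum]
    symm
    apply Finset.sum_bij (fun (j : ℕ) _ => (v : ℤ) - (j + 1))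
    · intro j hj
      have hc := (Finset.mem_filter.mp hj).2
      rw [Finset.mem_Icc]
      exact ⟨hc, by omega⟩
    · intro i _ j _ h
      omega
    · intro n hn
      rw [Finset.mem_Icc] at hn
      have h0 : 0 ≤ ⌊((v : ℝ) + b) / √2⌋ := Int.floor_nonneg.mpr (by positivity)
      refine ⟨((v : ℤ) - 1 - n).toNat, ?_, ?_⟩
      · rw [Finset.mem_filter, Finset.mem_range]
        refine ⟨by omega, ?_⟩
        unfold cond'
        omega
      · omega
    · intro j hj
      have hc := cond_bound hb0 (Finset.mem_filter.mp hj).2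
      have : (0:ℝ) ≤ j := Nat.cast_nonneg j
      rw [← aa_eq b v j (by linarith)]
      push_cast
      rfl
  · intro j hj
    rw [Finset.mem_range] at hj
    rw [if_neg]
    intro h
    have := cond_bound hb0 h
    have h2 : (v : ℝ) ≤ j := by exact_mod_cast not_lt.mp hj
    have : (0:ℝ) ≤ v := Nat.cast_nonneg v
    linarith

lemma cond_ev {b : ℝ} (hb1 : b < 1) (j : ℕ) : ∀ᶠ v : ℕ in atTop, cond' b v j := by
  filter_upwards [eventually_ge_atTop (4 * j + 20)] with v hv
  have hv' : (4:ℝ) * j + 20 ≤ v := by exact_mod_cast hv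
  unfold cond'
  rw [Int.add_one_le_iff, Int.floor_lt]
  push_cast
  have h0 : (4:ℝ)/3 ≤ √2 := by
    apply Real.le_sqrt_of_sq_le; norm_num
  rw [div_lt_iff₀ (by positivity)]
  have : (0:ℝ) ≤ j := Nat.cast_nonneg j
  nlinarith

lemma aa_lim {b : ℝ} (hb0 : 0 ≤ b) (hb1 : b < 1) (j : ℕ) :
    Tendsto (fun v : ℕ => aa b v j) atTop (𝓝 (∫ t in (0:ℝ)..(1/2), LL (j + 1 + b) t)) := by
  unfold aa
  have hj : (0:ℝ) ≤ j := Nat.cast_nonneg j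
  have big : ∀ᶠ v : ℕ in atTop, 2 * ((j:ℝ) + 1) ≤ v := by
    filter_upwards [cond_ev hb1 j] with v hv using cond_bound hb0 hv
  apply intervalIntegral.tendsto_integral_filter_of_dominated_convergence
    (fun _ => 5184 * (√((j:ℝ) + 1) / ((j:ℝ) + 1) ^ 2))
  · filter_upwards [big] with v hv
    apply Measurable.aestronglyMeasurable
    unfold FF
    fun_prop
  · filter_upwards [big] with v hv
    refine Eventually.of_forall fun t ht => ?_
    rw [Set.uIoc_of_le (by norm_num)] at ht
    rw [Real.norm_eq_abs]
    apply FF_bound hb0 hb1 (by linarith) hv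
    rw [abs_le]; constructor <;> linarith [ht.1, ht.2]
  · exact intervalIntegrable_const
  · refine Eventually.of_forall fun t ht => ?_
    rw [Set.uIoc_of_le (by norm_num)] at ht
    have l0 := FF_lim b (j + 1) (by linarith)
    have l1 := FF_lim b (j + 1 - t) (by linarith [ht.1, ht.2])
    have l2 := FF_lim b (j + 1 + t) (by linarith [ht.1, ht.2])
    have := ((l0.const_mul 2).sub l1).sub l2
    have e : 2 * (√2 * √(b + (↑j + 1))) - √2 * √(b + (↑j + 1 - t)) - √2 * √(b + (↑j + 1 + t))
        = LL (j + 1 + b) t := by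
      rw [LL, show b + ((j:ℝ) + 1) = j + 1 + b by ring,
        show b + ((j:ℝ) + 1 - t) = j + 1 + b - t by ring,
        show b + ((j:ℝ) + 1 + t) = j + 1 + b + t by ring]
      ring
    rw [e] at this
    refine this.congr fun v => ?_
    rw [show (v:ℝ) - (j + 1 - t) = v - (j + 1) + t by ring,
      show (v:ℝ) - (j + 1 + t) = v - (j + 1) - t by ring]
    ring

lemma aa_bound {b : ℝ} (hb0 : 0 ≤ b) (hb1 : b < 1) {v j : ℕ} (h : cond' b v j) :
    |aa b v j| ≤ 5184 * (√((j:ℝ) + 1) / ((j:ℝ) + 1) ^ 2) := by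
  have hj : (0:ℝ) ≤ j := Nat.cast_nonneg j
  have := intervalIntegral.norm_integral_le_of_norm_le_const (a := (0:ℝ)) (b := 1/2)
    (C := 5184 * (√((j:ℝ) + 1) / ((j:ℝ) + 1) ^ 2))
    (f := fun t => (v : ℝ) ^ ((3:ℝ)/2) * (2 * FF (v + b) (v - (j + 1))
    - FF (v + b) (v - (j + 1) + t) - FF (v + b) (v - (j + 1) - t))) (by
      intro t ht
      rw [Set.uIoc_of_le (by norm_num)] at ht
      rw [Real.norm_eq_abs]
      apply FF_bound hb0 hb1 (by linarith) (cond_bound hb0 h)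
      rw [abs_le]; constructor <;> linarith [ht.1, ht.2])
  rw [Real.norm_eq_abs] at this
  refine this.trans ?_
  have h0 : 0 ≤ 5184 * (√((j:ℝ) + 1) / ((j:ℝ) + 1) ^ 2) := by positivity
  rw [abs_of_nonneg (by norm_num)]
  linarith

lemma summ_bound : Summable (fun j : ℕ => 5184 * (√((j:ℝ) + 1) / ((j:ℝ) + 1) ^ 2)) := by
  apply Summable.mul_left
  have h : Summable (fun n : ℕ => 1 / (n:ℝ) ^ ((3:ℝ)/2)) :=
    Real.summable_one_div_nat_rpow.mpr (by norm_num)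
  have h' := (summable_nat_add_iff 1).mpr h
  refine h'.congr fun j => ?_
  push_cast
  have hj : (0:ℝ) < (j:ℝ) + 1 := by positivity
  rw [rpow32 _ hj]
  have : √((j:ℝ) + 1) ^ 2 = j + 1 := Real.sq_sqrt hj.le
  have : 0 < √((j:ℝ) + 1) := Real.sqrt_pos.mpr hj
  field_simp
  linarith

lemma int_sq (c : ℝ) : ∫ t in (0:ℝ)..(1/2), c * t ^ 2 = c / 24 := by
  rw [intervalIntegral.integral_const_mul, integral_pow]; norm_num; ring

lemma LL_bounds {s : ℝ} (hs : 1 ≤ s) :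
    √2 / 96 * (1 / (s * √s)) ≤ ∫ t in (0:ℝ)..(1/2), LL s t ∧
    ∫ t in (0:ℝ)..(1/2), LL s t ≤ √2 / 36 * (1 / (s * √s)) := by
  have hI : IntervalIntegrable (LL s) MeasureTheory.volume 0 (1/2) := by
    apply Continuous.intervalIntegrable
    unfold LL
    fun_prop
  have hc : ∀ c : ℝ, IntervalIntegrable (fun t => c * t ^ 2) MeasureTheory.volume 0 (1/2) := by
    intro c
    apply Continuous.intervalIntegrable
    fun_prop
  constructor
  · have := intervalIntegral.integral_mono_on (by norm_num)
      (hc (√2 / 4 * (1 / (s * √s)))) hI (by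
        intro t ht
        have := (sqrt_diff hs (t := t) (by rw [abs_le]; constructor <;> linarith [ht.1, ht.2])).1
        have := mul_le_mul_of_nonneg_left this (Real.sqrt_nonneg 2)
        rw [LL]
        refine le_trans (le_of_eq ?_) this
        ring)
    rw [int_sq] at this
    refine le_trans (le_of_eq ?_) this
    ring
  · have := intervalIntegral.integral_mono_on (by norm_num)
      hI (hc (√2 * 2 / 3 * (1 / (s * √s)))) (by
        intro t ht
        have := (sqrt_diff hs (t := t) (by rw [abs_le]; constructor <;> linarith [ht.1, ht.2])).2
        have := mul_le_mul_of_nonneg_left this (Real.sqrt_nonneg 2)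
        rw [LL]
        refine le_trans this (le_of_eq ?_)
        ring)
    rw [int_sq] at this
    refine le_trans this (le_of_eq ?_)
    ring

lemma tele {s : ℝ} (hs : 1 ≤ s) :
    2 * (1 / √s - 1 / √(s + 1)) ≤ 1 / (s * √s) ∧
    1 / ((s + 1) * √(s + 1)) ≤ 2 * (1 / √s - 1 / √(s + 1)) := by
  have hs0 : 0 < s := by linarith
  obtain ⟨a, ha⟩ : ∃ a, a = √s := ⟨_, rfl⟩
  obtain ⟨p, hp⟩ : ∃ a, a = √(s + 1) := ⟨_, rfl⟩
  have ha0 : 0 < a := by rw [ha]; exact Real.sqrt_pos.mpr hs0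
  have hp0 : 0 < p := by rw [hp]; exact Real.sqrt_pos.mpr (by linarith)
  have ha2 : a ^ 2 = s := by rw [ha]; exact Real.sq_sqrt hs0.le
  have hp2 : p ^ 2 = s + 1 := by rw [hp]; exact Real.sq_sqrt (by linarith)
  rw [← ha, ← hp, ← hp2, ← ha2]
  have hap : a < p := by
    rw [ha, hp]; exact Real.sqrt_lt_sqrt hs0.le (by linarith)
  have e1 : (p - a) * (p + a) = 1 := by nlinarith
  have e : 1 / a - 1 / p = 1 / (a * p * (p + a)) := by
    rw [show (1:ℝ) / (a * p * (p + a)) = ((p - a) * (p + a)) / (a * p * (p + a)) by rw [e1]]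
    field_simp
  rw [e, mul_one_div]
  constructor
  · rw [div_le_div_iff₀ (by positivity) (by positivity)]
    have h1 : a * a ≤ p * p := by nlinarith
    have h2 : a * a ≤ a * p := by nlinarith
    have : a * (2 * (a * a)) ≤ a * (p * p + a * p) := by
      apply mul_le_mul_of_nonneg_left _ ha0.le; linarith
    nlinarith
  · rw [div_le_div_iff₀ (by positivity) (by positivity)]
    have h1 : a * a ≤ p * p := by nlinarith
    have h2 : a * p ≤ p * p := by nlinarith
    have : p * (a * p + a * a) ≤ p * (2 * (p * p)) := by
      apply mul_le_mul_of_nonneg_left _ hp0.le; linarith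
    nlinarith

/-- For `b ∈ [0,1)` the limit `ε(b) = lim_{v→∞} S(v)` exists and satisfies
`(1/36)/√(3(b+1)) ≤ ε(b) ≤ (1/12)(1/√(b+1))(2b+3)/(2b+2)`. -/
theorem epsilon_exists_and_bounds (b : ℝ) (hb : b ∈ Set.Ico (0:ℝ) 1) :
    ∃ ε : ℝ, Tendsto (fun v : ℕ => Ssum b v) atTop (nhds ε) ∧
      (1/36) * (1 / Real.sqrt (3 * (b + 1))) ≤ ε ∧
      ε ≤ (1/12) * (1 / Real.sqrt (b + 1)) * ((2*b+3) / (2*b+2)) := by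
  classical
  obtain ⟨hb0, hb1⟩ := hb
  have hlim : ∀ j : ℕ, Tendsto (fun v : ℕ => if cond' b v j then aa b v j else 0) atTop
      (𝓝 (∫ t in (0:ℝ)..(1/2), LL (j + 1 + b) t)) := by
    intro j
    refine (aa_lim hb0 hb1 j).congr' ?_
    filter_upwards [cond_ev hb1 j] with v hv
    rw [if_pos hv]
  have hbd : ∀ v j : ℕ, ‖(if cond' b v j then aa b v j else 0)‖
      ≤ 5184 * (√((j:ℝ) + 1) / ((j:ℝ) + 1) ^ 2) := by
    intro v j
    split_ifs with h
    · exact aa_bound hb0 hb1 h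
    · rw [norm_zero]; positivity
  have hB : ∀ j : ℕ, _ := fun j : ℕ => LL_bounds (s := j + 1 + b) (by
    have : (0:ℝ) ≤ j := Nat.cast_nonneg j
    linarith)
  have h1 : ∀ j : ℕ, 1 ≤ (j:ℝ) + 1 + b := fun j => by
    have : (0:ℝ) ≤ j := Nat.cast_nonneg j
    linarith
  have hsum : Summable (fun j : ℕ => ∫ t in (0:ℝ)..(1/2), LL (j + 1 + b) t) := by
    apply Summable.of_norm_bounded summ_bound
    intro j
    exact le_of_tendsto (hlim j).norm (Eventually.of_forall fun v => hbd v j)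
  have h2p : 0 < √(2:ℝ) := by positivity
  have hq : 0 < √(b + 1) := Real.sqrt_pos.mpr (by linarith)
  have s2 : √(2:ℝ) ^ 2 = 2 := Real.sq_sqrt (by norm_num)
  refine ⟨∑' j : ℕ, ∫ t in (0:ℝ)..(1/2), LL (j + 1 + b) t, ?_, ?_, ?_⟩
  · simp_rw [Ssum_eq hb0]
    exact tendsto_tsum_of_dominated_convergence summ_bound hlim
      (Eventually.of_forall fun v j => hbd v j)
  · have part : ∀ N : ℕ, √2 / 48 * (1 / √(b + 1) - 1 / √(N + 1 + b))
        ≤ ∑ j ∈ Finset.range N, ∫ t in (0:ℝ)..(1/2), LL (j + 1 + b) t := by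
      intro N
      induction N with
      | zero => simp [add_comm]
      | succ N ih =>
        rw [Finset.sum_range_succ]
        have h3 := (hB N).1
        have h4 := mul_le_mul_of_nonneg_left (tele (h1 N)).1 (show 0 ≤ √2 / 96 by positivity)
        push_cast
        rw [show (N:ℝ) + 1 + 1 + b = N + 1 + b + 1 by ring]
        linarith
    have lz : Tendsto (fun N : ℕ => 1 / √((N:ℝ) + 1 + b)) atTop (𝓝 0) := by
      simp_rw [one_div]
      apply Tendsto.inv_tendsto_atTop
      apply Real.tendsto_sqrt_atTop.comp
      apply tendsto_atTop_add_const_right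
      apply tendsto_atTop_add_const_right
      exact tendsto_natCast_atTop_atTop
    have l1 : Tendsto (fun N : ℕ => √2 / 48 * (1 / √(b + 1) - 1 / √((N:ℝ) + 1 + b))) atTop
        (𝓝 (√2 / 48 * (1 / √(b + 1) - 0))) := (lz.const_sub _).const_mul _
    have := le_of_tendsto_of_tendsto' l1 hsum.hasSum.tendsto_sum_nat part
    refine le_trans ?_ this
    have h3 : (4/3:ℝ) ≤ √3 := by apply Real.le_sqrt_of_sq_le; norm_num
    have h2 : (4/3:ℝ) ≤ √2 := by apply Real.le_sqrt_of_sq_le; norm_num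
    rw [Real.sqrt_mul (by norm_num), sub_zero]
    have h4 : 1 / (√3 * √(b + 1)) ≤ 3 / 4 * (1 / √(b + 1)) := by
      rw [mul_one_div, div_le_div_iff₀ (by positivity) hq]
      nlinarith
    have h5 : 0 < 1 / √(b + 1) := by positivity
    nlinarith
  · have part : ∀ N : ℕ, ∑ j ∈ Finset.range (N + 1), ∫ t in (0:ℝ)..(1/2), LL (j + 1 + b) t
        ≤ √2 / 36 * (1 / ((b + 1) * √(b + 1)) + 2 * (1 / √(b + 1) - 1 / √(N + 1 + b))) := by
      intro N
      induction N with
      | zero =>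
        have := (hB 0).2
        simpa [add_comm] using this
      | succ N ih =>
        rw [Finset.sum_range_succ]
        have h3 := (hB (N + 1)).2
        have h4 := mul_le_mul_of_nonneg_left (tele (h1 N)).2 (show 0 ≤ √2 / 36 by positivity)
        push_cast at h3 ⊢
        rw [show (N:ℝ) + 1 + 1 + b = N + 1 + b + 1 by ring] at h3 ⊢
        linarith
    have l1 := (tendsto_add_atTop_iff_nat 1).mpr hsum.hasSum.tendsto_sum_nat
    refine le_of_tendsto' l1 fun N => (part N).trans ?_
    have h5 : 0 < 1 / √(b + 1) := by positivity
    have h6 : 0 ≤ 1 / √((N:ℝ) + 1 + b) := by positivity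
    have h7 : √(2:ℝ) ≤ 3 / 2 := by rw [Real.sqrt_le_left] <;> norm_num
    have hb2 : 0 < b + 1 := by linarith
    have e1 : (1 / 12) * (1 / √(b + 1)) * ((2 * b + 3) / (2 * b + 2))
        = 1 / 24 * (1 / ((b + 1) * √(b + 1)) + 2 * (1 / √(b + 1))) := by
      rw [show 2 * b + 2 = 2 * (b + 1) by ring]
      field_simp
      ring
    rw [e1]
    apply mul_le_mul
    · linarith
    · linarith
    · have h8 : 1 / √((N:ℝ) + 1 + b) ≤ 1 / √(b + 1) := by
        apply one_div_le_one_div_of_le hq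
        apply Real.sqrt_le_sqrt
        have : (0:ℝ) ≤ N := Nat.cast_nonneg N
        linarith
      have : 0 < 1 / ((b + 1) * √(b + 1)) := by positivity
      linarith
    · norm_num
end

section
/- Fix b ∈ [0,1). For v ∈ ℕ let α = (v + b)², v₁ = ⌊(v+b)/√2⌋, and define 𝒯′(α) = 4·[ 1/(2v₁+1)² − 4·Σ_{n=v₁+1}^{v} 1/((4n² − 1)(2⌊√(α − n²)⌋ + 1)) ]. Then, as v → ∞, (1/2)(2v₁+1)²·𝒯′(α) converges to −4 if b = 0, and converges to 0 if b > 0. -/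
open Filter Topology

/-- The explicit formula for the derivative of the period function:
`𝒯′(α) = 4·[1/(2v₁+1)² − 4·Σ_{n=v₁+1}^{v} 1/((4n²−1)(2⌊√(α−n²)⌋+1))]`, where
`α = (v+b)²` and `v₁ = ⌊√(α/2)⌋ = ⌊(v+b)/√2⌋`. -/
noncomputable def Tderiv (b : ℝ) (v : ℕ) : ℝ :=
  4 * (1 / (2 * (⌊((v : ℝ) + b) / Real.sqrt 2⌋ : ℝ) + 1)^2 -
    4 * ∑ n ∈ Finset.Icc (⌊((v : ℝ) + b) / Real.sqrt 2⌋ + 1) (v : ℤ),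
      1 / ((4 * (n : ℝ)^2 - 1) *
        (2 * (⌊Real.sqrt (((v : ℝ) + b)^2 - (n : ℝ)^2)⌋ : ℝ) + 1)))

lemma tele_s16 (f : ℤ → ℝ) (a k : ℤ) (h : a ≤ k) :
    ∑ n ∈ Finset.Icc (a+1) k, (f n - f (n+1)) = f (a+1) - f (k+1) := by
  induction k, h using Int.le_induction with
  | base => simp
  | succ k hk ih =>
    have : Finset.Icc (a+1) (k+1) = insert (k+1) (Finset.Icc (a+1) k) := by
      ext x; simp only [Finset.mem_Icc, Finset.mem_insert]; omega
    rw [this, Finset.sum_insert (by simp), ih]; ring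

lemma stepU (R n s t : ℝ) (hn : 0 < n) (hs : 0 < s) (ht : 0 ≤ t) (hts : t ≤ s)
    (h1 : s^2 = R^2 - n^2) (h2 : t^2 = R^2 - (n+1)^2) :
    R^2 / (n^2 * s) ≤ (1+1/n)^2 * (s/n - t/(n+1)) := by
  have e : s/n - t/(n+1) = (R^2 + s*t + n^2 + n) / ((s+t)*(n*(n+1))) := by
    have : s + t ≠ 0 := by positivity
    field_simp
    have : t^2 = s^2 - 2*n - 1 := by linarith
    have : R^2 = s^2+n^2 := by linarith
    rw [this]
    linear_combination (-n) * (h2 - h1)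
  have e2 : (1+1/n)^2 * ((R^2 + s*t + n^2 + n) / ((s+t)*(n*(n+1))))
      = ((n+1)*(R^2 + s*t + n^2 + n)) / ((s+t)*n^3) := by
    have : s + t ≠ 0 := by positivity
    field_simp
  rw [e, e2, div_le_div_iff₀ (by positivity) (by positivity)]
  have hR : R^2 = s^2+n^2 := by linarith
  have key : R^2 * n * (s+t) ≤ (n+1) * s * (R^2 + s*t+n^2+n) := by
    rw [hR]
    have : 0 ≤ n^3 * (s - t) := mul_nonneg (by positivity) (by linarith)
    have p : 0 ≤ s^2*t + s*(2*n^2+n) + s*(s^2+n^2) := by positivity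
    nlinarith
  have := mul_le_mul_of_nonneg_right key (by positivity : 0 ≤ n^2)
  nlinarith

lemma stepL (R m s t : ℝ) (hn : 0 < m) (ht : 0 < t) (hts : t ≤ s) (hm : 1 ≤ m)
    (h1 : s^2 = R^2 - m^2) (h2 : t^2 = R^2 - (m+1)^2) :
    (1-1/(m+1))^2 * (s/m - t/(m+1)) ≤ R^2 / ((m+1)^2 * t) := by
  have hs : 0 < s := by linarith
  have e : s/m - t/(m+1) = (R^2 + s*t + m^2 + m) / ((s+t)*(m*(m+1))) := by
    have : s + t ≠ 0 := by positivity
    field_simp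
    have : R^2 = s^2+m^2 := by linarith
    rw [this]
    linear_combination (-m) * (h2 - h1)
  have e2 : (1-1/(m+1))^2 * ((R^2 + s*t + m^2 + m) / ((s+t)*(m*(m+1))))
      = (m*(R^2 + s*t + m^2 + m)) / ((s+t)*(m+1)^3) := by
    have : s + t ≠ 0 := by positivity
    field_simp
    ring
  rw [e, e2, div_le_div_iff₀ (by positivity) (by positivity)]
  have hR : R^2 = s^2+m^2 := by linarith
  have key : m * t * (R^2 + s*t+m^2+m) ≤ R^2 * (s+t) * (m+1) := by
    have a1 : s*t ≤ s^2 := by nlinarith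
    have a2 : m * t * (R^2 + s*t+m^2+m) ≤ m * t * (R^2 + R^2 + m) :=
      mul_le_mul_of_nonneg_left (by linarith) (by positivity)
    have a3 : t * (m*R^2 + m^2) ≤ s * (m*R^2+m^2) :=
      mul_le_mul_of_nonneg_right hts (by positivity)
    have a4 : s * m^2 ≤ s * R^2 := mul_le_mul_of_nonneg_left (by nlinarith) hs.le
    have a5 : 0 ≤ t * R^2 := by positivity
    nlinarith
  have := mul_le_mul_of_nonneg_right key (by positivity : 0 ≤ (m+1)^2)
  nlinarith

/-- summand -/
noncomputable def aTerm (R : ℝ) (n : ℤ) : ℝ :=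
  1 / ((4 * (n : ℝ)^2 - 1) * (2 * (⌊Real.sqrt (R^2 - (n : ℝ)^2)⌋ : ℝ) + 1))

noncomputable def gTerm (R : ℝ) (n : ℤ) : ℝ := Real.sqrt (R^2 - (n : ℝ)^2) / n

lemma aUpper (R S N : ℝ) (n : ℤ) (hN : 1 ≤ N) (hn : N ≤ n) (hS : 1 ≤ S)
    (hs : S ≤ Real.sqrt (R^2 - (n : ℝ)^2)) (hR : (n:ℝ) + 1 ≤ R) :
    8 * R^2 * aTerm R n ≤
      ((1+1/N)^2 * (1/((1-1/(4*N^2)) * (1 - 1/(2*S))))) * (gTerm R n - gTerm R (n+1)) := by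
  have hn0 : (0:ℝ) < n := by linarith
  have hn1 : (1:ℝ) ≤ n := by linarith
  have r1 : 0 ≤ R^2 - (n:ℝ)^2 := by nlinarith
  have r2 : 0 ≤ R^2 - ((n:ℝ)+1)^2 := by nlinarith
  have u := stepU R n (Real.sqrt (R^2 - (n : ℝ)^2)) (Real.sqrt (R^2 - ((n : ℝ)+1)^2)) hn0
    (by linarith) (Real.sqrt_nonneg _) (Real.sqrt_le_sqrt (by nlinarith))
    (Real.sq_sqrt r1) (Real.sq_sqrt r2)
  have fl := Int.lt_floor_add_one (Real.sqrt (R^2 - (n : ℝ)^2))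
  unfold aTerm gTerm
  push_cast
  set s := Real.sqrt (R^2 - (n : ℝ)^2)
  set D := s/n - Real.sqrt (R^2 - ((n : ℝ)+1)^2) / (n+1)
  have hs0 : 0 < s := by linarith
  have c1 : 0 < 1 - 1/(4*N^2) := by
    have : 1/(4*N^2) < 1 := by rw [div_lt_one (by positivity)]; nlinarith
    linarith
  have c2 : 0 < 1 - 1/(2*S) := by
    have : 1/(2*S) < 1 := by rw [div_lt_one (by positivity)]; nlinarith
    linarith
  have d1 : n^2 * (1 - 1/(4*N^2)) * 4 ≤ 4 * (n:ℝ)^2 - 1 := by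
    have : 1 ≤ (n:ℝ)^2 / N^2 := by rw [le_div_iff₀ (by positivity)]; nlinarith
    have e : n^2 * (1 - 1/(4*N^2)) * 4 = 4 * (n:ℝ)^2 - (n:ℝ)^2 / N^2 := by field_simp
    linarith
  have d2 : s * (1 - 1/(2*S)) * 2 ≤ 2 * (⌊s⌋:ℝ) + 1 := by
    have : 1 ≤ s / S := by rw [le_div_iff₀ (by positivity)]; linarith
    have e : s * (1 - 1/(2*S)) * 2 = 2 * s - s/S := by field_simp
    linarith
  have q : 1 / ((4 * (n : ℝ)^2 - 1) * (2 * (⌊s⌋ : ℝ) + 1)) ≤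
      1 / ((n^2 * (1 - 1/(4*N^2)) * 4) * (s * (1 - 1/(2*S)) * 2)) := by
    apply one_div_le_one_div_of_le (by positivity)
    exact mul_le_mul d1 d2 (by positivity) (le_trans (by positivity) d1)
  have D0 : 0 ≤ D := by
    by_contra h
    have : 0 ≤ R^2 / (n^2 * s) := by positivity
    have : (1+1/(n:ℝ))^2 * D < 0 := mul_neg_of_pos_of_neg (by positivity) (by linarith)
    linarith
  have w : (1+1/(n:ℝ))^2 ≤ (1+1/N)^2 := by gcongr
  set c := (1 - 1/(4*N^2)) * (1 - 1/(2*S)) with hc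
  have c0 : 0 < c := by positivity
  calc _ ≤ 8 * R^2 * (1 / ((n^2 * (1 - 1/(4*N^2)) * 4) * (s * (1 - 1/(2*S)) * 2))) :=
        mul_le_mul_of_nonneg_left q (by positivity)
    _ = 1/c * (R^2 / (n^2 * s)) := by
        have : (n^2 * (1 - 1/(4*N^2)) * 4) * (s * (1 - 1/(2*S)) * 2) = 8 * n^2 * s * c := by
          rw [hc]; ring
        rw [this]; field_simp
    _ ≤ 1/c * ((1+1/N)^2 * D) := by
        apply mul_le_mul_of_nonneg_left _ (by positivity)
        exact u.trans (mul_le_mul_of_nonneg_right w D0)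
    _ = _ := by ring

lemma aLower (R S N : ℝ) (n : ℤ) (hN : 1 ≤ N) (hn : N + 1 ≤ n) (hS : 1 ≤ S)
    (hs : S ≤ Real.sqrt (R^2 - (n : ℝ)^2)) (hR : (n:ℝ) + 1 ≤ R) :
    ((1-1/N)^2 * (1/(1 + 1/(2*S)))) * (gTerm R (n-1) - gTerm R (n-1+1)) ≤
    8 * R^2 * aTerm R n := by
  have hn0 : (0:ℝ) < n - 1 := by linarith
  have hn2 : (0:ℝ) < n := by linarith
  have hn1 : (1:ℝ) ≤ n - 1 := by linarith
  have r1 : 0 ≤ R^2 - (n:ℝ)^2 := by nlinarith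
  have r2 : 0 ≤ R^2 - ((n:ℝ)-1)^2 := by nlinarith
  have hts : Real.sqrt (R^2 - (n : ℝ)^2) ≤ Real.sqrt (R^2 - ((n : ℝ)-1)^2) :=
    Real.sqrt_le_sqrt (by nlinarith)
  have u := stepL R (n-1) (Real.sqrt (R^2 - ((n : ℝ)-1)^2)) (Real.sqrt (R^2 - (n : ℝ)^2)) hn0
    (by linarith) hts hn1
    (Real.sq_sqrt r2) (by rw [Real.sq_sqrt r1]; ring)
  have fl := Int.floor_le (Real.sqrt (R^2 - (n : ℝ)^2))
  have fl0 : (0:ℝ) ≤ ⌊Real.sqrt (R^2 - (n : ℝ)^2)⌋ := by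
    exact_mod_cast Int.floor_nonneg.2 (Real.sqrt_nonneg _)
  unfold aTerm gTerm
  push_cast
  simp only [sub_add_cancel] at u ⊢
  set t := Real.sqrt (R^2 - (n : ℝ)^2)
  set s := Real.sqrt (R^2 - ((n : ℝ)-1)^2)
  have ht0 : 0 < t := by linarith
  have D0 : 0 ≤ s/(n-1) - t/n := by
    have : t / n ≤ s/(n-1) := by gcongr; linarith
    linarith
  set D := s/(n-1) - t / n
  have d2 : 2 * (⌊t⌋:ℝ) + 1 ≤ t * (1 + 1/(2*S)) * 2 := by
    have : 1 ≤ t / S := by rw [le_div_iff₀ (by positivity)]; linarith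
    have e : t * (1 + 1/(2*S)) * 2 = 2 * t + t/S := by field_simp
    linarith
  have hp : 0 < 4 * (n : ℝ)^2 - 1 := by nlinarith
  have q : 1 / ((4 * (n:ℝ)^2) * (t * (1 + 1/(2*S)) * 2)) ≤ 
     1 / ((4 * (n : ℝ)^2 - 1) * (2 * (⌊t⌋ : ℝ) + 1)) := by
    apply one_div_le_one_div_of_le (by positivity)
    exact mul_le_mul (by linarith) d2 (by positivity) (by positivity)
  have w : (1-1/N)^2 ≤ (1-1/(n:ℝ))^2 := by
    have h1 : 1/N ≤ 1 := by rw [div_le_one (by linarith)]; exact hN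
    have h2 : 1/(n:ℝ) ≤ 1/N := by gcongr; linarith
    exact pow_le_pow_left₀ (by linarith) (by linarith) 2
  set c := (1 + 1/(2*S)) with hc
  have c0 : 0 < c := by positivity
  calc _ = 1/c * ((1-1/N)^2 * D) := by ring
    _ ≤ 1/c * (R^2 / (n^2 * t)) := by
        apply mul_le_mul_of_nonneg_left _ (by positivity)
        exact (mul_le_mul_of_nonneg_right w D0).trans u
    _ = 8 * R^2 * (1 / ((4 * (n:ℝ)^2) * (t * c * 2))) := by field_simp; ring
    _ ≤ _ := mul_le_mul_of_nonneg_left q (by positivity)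

lemma sumBounds (b : ℝ) (hb0 : 0 ≤ b) (hb1 : b < 1) (v : ℕ) (N : ℤ)
    (hN : N = ⌊((v : ℝ) + b) / Real.sqrt 2⌋) (hN1 : 1 ≤ N) (hNv : N + 1 ≤ v - 1) :
    8 * ((v:ℝ)+b)^2 * ∑ n ∈ Finset.Icc (N+1) ((v:ℤ)-1), aTerm ((v:ℝ)+b) n ≤
      ((1+1/(N:ℝ))^2 * (1/((1-1/(4*(N:ℝ)^2)) * (1 - 1/(2*Real.sqrt v))))) ∧
    ((1-1/(N:ℝ))^2 * (1/(1 + 1/(2*Real.sqrt v)))) * (1 - 2 * Real.sqrt v / ((v:ℝ)-1)) ≤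
    8 * ((v:ℝ)+b)^2 * ∑ n ∈ Finset.Icc (N+1) ((v:ℤ)-1), aTerm ((v:ℝ)+b) n := by
  set R := (v:ℝ)+b with hR
  have hN1' : (1:ℝ) ≤ N := by exact_mod_cast hN1
  have hNv' : (N:ℝ) + 1 ≤ v - 1 := by exact_mod_cast hNv
  have hS : 1 ≤ Real.sqrt v := by rw [Real.one_le_sqrt]; linarith
  have two : Real.sqrt 2 ^ 2 = 2 := Real.sq_sqrt (by norm_num)
  have two0 : 0 < Real.sqrt 2 := by positivity
  have R0 : 0 < R := by linarith
  have f1 : (N:ℝ) ≤ R / Real.sqrt 2 := by rw [hN]; exact Int.floor_le _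
  have f2 : R / Real.sqrt 2 < N + 1 := by rw [hN]; exact Int.lt_floor_add_one _
  have hsq : (R / Real.sqrt 2)^2 = R^2/2 := by rw [div_pow, two]
  have f3 : (N:ℝ)^2 ≤ R^2/2 := by rw [← hsq]; gcongr
  have f4 : R^2/2 ≤ ((N:ℝ)+1)^2 := by rw [← hsq]; gcongr
  have hs : ∀ n ∈ Finset.Icc (N+1) ((v:ℤ)-1), (N:ℝ) + 1 ≤ n ∧ (n:ℝ) ≤ v - 1 ∧
      Real.sqrt v ≤ Real.sqrt (R^2 - (n:ℝ)^2) := by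
    intro n hn
    rw [Finset.mem_Icc] at hn
    have h1 : (N:ℝ) + 1 ≤ n := by exact_mod_cast hn.1
    have h2 : (n:ℝ) ≤ v - 1 := by exact_mod_cast hn.2
    refine ⟨h1, h2, Real.sqrt_le_sqrt ?_⟩
    nlinarith
  have hle : N ≤ (v:ℤ) - 1 := by omega
  constructor
  · rw [Finset.mul_sum]
    set c := ((1+1/(N:ℝ))^2 * (1/((1-1/(4*(N:ℝ)^2)) * (1 - 1/(2*Real.sqrt v))))) with hc
    have c0 : 0 ≤ c := by
      have c1 : 0 < 1 - 1/(4*(N:ℝ)^2) := by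
        have : 1/(4*(N:ℝ)^2) < 1 := by rw [div_lt_one (by positivity)]; nlinarith
        linarith
      have c2 : 0 < 1 - 1/(2*Real.sqrt v) := by
        have : 1/(2*Real.sqrt v) < 1 := by rw [div_lt_one (by positivity)]; nlinarith
        linarith
      positivity
    calc _ ≤ ∑ n ∈ Finset.Icc (N+1) ((v:ℤ)-1), c * (gTerm R n - gTerm R (n+1)) := by
          apply Finset.sum_le_sum
          intro n hn
          obtain ⟨h1, h2, h3⟩ := hs n hn
          exact aUpper R _ N n hN1' (by linarith) hS h3 (by linarith)
      _ = c * (gTerm R (N+1) - gTerm R ((v:ℤ)-1+1)) := by rw [← Finset.mul_sum, tele_s16 _ _ _ hle]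
      _ ≤ c * 1 := by
          apply mul_le_mul_of_nonneg_left _ c0
          have g1 : gTerm R (N+1) ≤ 1 := by
            unfold gTerm; push_cast
            rw [div_le_one (by positivity)]
            apply Real.sqrt_le_iff.2
            constructor
            · positivity
            · linarith
          have g2 : 0 ≤ gTerm R ((v:ℤ)-1+1) := by unfold gTerm; simp; positivity
          linarith
      _ = c := mul_one c
  · rw [Finset.mul_sum]
    set c := ((1-1/(N:ℝ))^2 * (1/(1 + 1/(2*Real.sqrt v)))) with hc
    have c0 : 0 ≤ c := by positivity
    calc _ ≤ c * (gTerm R N - gTerm R ((v:ℤ)-1)) := by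
          apply mul_le_mul_of_nonneg_left _ c0
          have g1 : 1 ≤ gTerm R N := by
            unfold gTerm
            rw [le_div_iff₀ (by positivity), one_mul]
            apply Real.le_sqrt_of_sq_le
            linarith
          have g2 : gTerm R ((v:ℤ)-1) ≤ 2 * Real.sqrt v / ((v:ℝ)-1) := by
            unfold gTerm; push_cast
            apply div_le_div_of_nonneg_right _ (by linarith)
            apply Real.sqrt_le_iff.2
            constructor
            · positivity
            · rw [mul_pow, Real.sq_sqrt (by positivity)]; nlinarith
          linarith
      _ = ∑ n ∈ Finset.Icc (N+1) ((v:ℤ)-1), c * (gTerm R (n-1) - gTerm R (n-1+1)) := by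
          have := tele_s16 (fun n => gTerm R (n-1)) N ((v:ℤ)-1) hle
          rw [← Finset.mul_sum]
          simp only [add_sub_cancel_right, sub_add_cancel] at this ⊢
          rw [this]
      _ ≤ _ := by
          apply Finset.sum_le_sum
          intro n hn
          obtain ⟨h1, h2, h3⟩ := hs n hn
          exact aLower R _ N n hN1' (by linarith) hS h3 (by linarith)

lemma R_top (b : ℝ) : Tendsto (fun v : ℕ => (v:ℝ) + b) atTop atTop :=
  tendsto_atTop_add_const_right _ _ tendsto_natCast_atTop_atTop

lemma N_top (b : ℝ) : Tendsto (fun v : ℕ => (⌊((v : ℝ) + b) / Real.sqrt 2⌋)) atTop atTop :=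
  tendsto_floor_atTop.comp ((R_top b).atTop_div_const (by positivity))

lemma NR_top (b : ℝ) :
    Tendsto (fun v : ℕ => ((⌊((v : ℝ) + b) / Real.sqrt 2⌋ : ℤ) : ℝ)) atTop atTop :=
  tendsto_intCast_atTop_atTop.comp (N_top b)

lemma sqrt_top : Tendsto (fun v : ℕ => Real.sqrt v) atTop atTop :=
  Real.tendsto_sqrt_atTop.comp tendsto_natCast_atTop_atTop

lemma LR_lim (b : ℝ) : Tendsto (fun v : ℕ =>
    (2 * (⌊((v : ℝ) + b) / Real.sqrt 2⌋ : ℝ) + 1)^2 / ((v:ℝ)+b)^2) atTop (nhds 2) := by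
  have two : Real.sqrt 2 ^ 2 = 2 := Real.sq_sqrt (by norm_num)
  have h : Tendsto (fun v : ℕ =>
    (2 * (⌊((v : ℝ) + b) / Real.sqrt 2⌋ : ℝ) + 1) / ((v:ℝ)+b)) atTop (nhds (Real.sqrt 2)) := by
    have i1 : Tendsto (fun v : ℕ => 1 / ((v:ℝ)+b)) atTop (nhds 0) := (R_top b).const_div_atTop 1
    have l : Tendsto (fun v : ℕ => Real.sqrt 2 - 1 / ((v:ℝ)+b)) atTop (nhds (Real.sqrt 2)) := by
      simpa using i1.const_sub (Real.sqrt 2)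
    have u : Tendsto (fun v : ℕ => Real.sqrt 2 + 1 / ((v:ℝ)+b)) atTop (nhds (Real.sqrt 2)) := by
      simpa using i1.const_add (Real.sqrt 2)
    have e : ∀ R : ℝ, R / Real.sqrt 2 = Real.sqrt 2 * R / 2 := by
      intro R; rw [div_eq_div_iff (by positivity) (by norm_num)]; linear_combination (-R) * two
    refine tendsto_of_tendsto_of_tendsto_of_le_of_le' l u ?_ ?_
    · filter_upwards [(R_top b).eventually_gt_atTop 0] with v hv
      rw [le_div_iff₀ hv, sub_mul, one_div_mul_cancel hv.ne']
      have := Int.lt_floor_add_one (((v : ℝ) + b) / Real.sqrt 2)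
      have := e (v+b)
      linarith
    · filter_upwards [(R_top b).eventually_gt_atTop 0] with v hv
      rw [div_le_iff₀ hv, add_mul, one_div_mul_cancel hv.ne']
      have := Int.floor_le (((v : ℝ) + b) / Real.sqrt 2)
      have := e (v+b)
      linarith
  have := h.pow 2
  rw [two] at this
  simpa only [div_pow] using this

lemma sum_lim (b : ℝ) (hb0 : 0 ≤ b) (hb1 : b < 1) : Tendsto (fun v : ℕ =>
    8 * ((v:ℝ)+b)^2 * ∑ n ∈ Finset.Icc (⌊((v : ℝ) + b) / Real.sqrt 2⌋+1) ((v:ℤ)-1),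
      aTerm ((v:ℝ)+b) n) atTop (nhds 1) := by
  have i1 : Tendsto (fun v : ℕ => 1 / (⌊((v : ℝ) + b) / Real.sqrt 2⌋ : ℝ)) atTop (nhds 0) :=
    (NR_top b).const_div_atTop 1
  have i2 : Tendsto (fun v : ℕ => 1 / (2 * Real.sqrt v)) atTop (nhds 0) :=
    (sqrt_top.const_mul_atTop (by norm_num : (0:ℝ) < 2)).const_div_atTop 1
  have i3 : Tendsto (fun v : ℕ => 1 / (4 * (⌊((v : ℝ) + b) / Real.sqrt 2⌋ : ℝ)^2)) atTop
      (nhds 0) := by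
    have := (i1.pow 2).const_mul (1/4)
    simp only [ne_eq, OfNat.ofNat_ne_zero, not_false_eq_true, zero_pow, mul_zero] at this
    refine this.congr fun v => ?_
    rw [div_pow, one_pow, div_mul_div_comm, one_mul]
  have i4 : Tendsto (fun v : ℕ => 2 * Real.sqrt v / ((v:ℝ)-1)) atTop (nhds 0) := by
    have u : Tendsto (fun v : ℕ => 4 * (1 / Real.sqrt v)) atTop (nhds 0) := by
      simpa using (sqrt_top.const_div_atTop 1).const_mul 4
    refine squeeze_zero' ?_ ?_ u
    · filter_upwards [eventually_ge_atTop 2] with v hv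
      have : (2:ℝ) ≤ v := by exact_mod_cast hv
      apply div_nonneg (by positivity); linarith
    · filter_upwards [eventually_ge_atTop 2] with v hv
      have : (2:ℝ) ≤ v := by exact_mod_cast hv
      have h0 : 0 < Real.sqrt v := Real.sqrt_pos.2 (by linarith)
      rw [mul_one_div, div_le_div_iff₀ (by linarith) h0]
      nlinarith [Real.sq_sqrt (by linarith : (0:ℝ) ≤ v)]
  have U : Tendsto (fun v : ℕ => ((1+1/(⌊((v : ℝ) + b) / Real.sqrt 2⌋:ℝ))^2 *
      (1/((1-1/(4*(⌊((v : ℝ) + b) / Real.sqrt 2⌋:ℝ)^2)) * (1 - 1/(2*Real.sqrt v))))))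
      atTop (nhds 1) := by
    have := ((i1.const_add 1).pow 2).mul
      ((tendsto_const_nhds (x := (1:ℝ))).div ((i3.const_sub 1).mul (i2.const_sub 1)) (by norm_num))
    convert this using 2
    all_goals norm_num
  have L : Tendsto (fun v : ℕ => ((1-1/(⌊((v : ℝ) + b) / Real.sqrt 2⌋:ℝ))^2 *
      (1/(1 + 1/(2*Real.sqrt v)))) * (1 - 2 * Real.sqrt v / ((v:ℝ)-1)))
      atTop (nhds 1) := by
    have := (((i1.const_sub 1).pow 2).mul
      ((tendsto_const_nhds (x := (1:ℝ))).div (i2.const_add 1) (by norm_num))).mul (i4.const_sub 1)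
    convert this using 2
    all_goals norm_num
  have ev : ∀ᶠ v : ℕ in atTop, 1 ≤ ⌊((v : ℝ) + b) / Real.sqrt 2⌋ ∧
      ⌊((v : ℝ) + b) / Real.sqrt 2⌋ + 1 ≤ (v:ℤ) - 1 := by
    filter_upwards [(N_top b).eventually_ge_atTop 1, eventually_ge_atTop 12] with v h1 h2
    refine ⟨h1, ?_⟩
    have h2' : (12:ℝ) ≤ v := by exact_mod_cast h2
    have f := Int.floor_le (((v : ℝ) + b) / Real.sqrt 2)
    have : ((v : ℝ) + b) / Real.sqrt 2 ≤ v - 2 := by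
      have s : (1.4:ℝ) ≤ Real.sqrt 2 := Real.le_sqrt_of_sq_le (by norm_num)
      rw [div_le_iff₀ (by positivity)]
      nlinarith
    have : (⌊((v : ℝ) + b) / Real.sqrt 2⌋ : ℝ) + 1 ≤ (v:ℝ) - 1 := by linarith
    exact_mod_cast this
  refine tendsto_of_tendsto_of_tendsto_of_le_of_le' L U ?_ ?_
  · filter_upwards [ev] with v hv
    exact (sumBounds b hb0 hb1 v _ rfl hv.1 hv.2).2
  · filter_upwards [ev] with v hv
    exact (sumBounds b hb0 hb1 v _ rfl hv.1 hv.2).1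

lemma main_lim (b : ℝ) (hb0 : 0 ≤ b) (hb1 : b < 1) (l : ℝ)
    (hl : Tendsto (fun v : ℕ => 1 / (2 * (⌊Real.sqrt (((v:ℝ)+b)^2 - ((v:ℤ):ℝ)^2)⌋ : ℝ) + 1))
      atTop (nhds l)) :
    Tendsto (fun v : ℕ =>
          (1/2) * (2 * (⌊((v : ℝ) + b) / Real.sqrt 2⌋ : ℝ) + 1)^2 * Tderiv b v)
        atTop (nhds (-4 * l)) := by
  have q : Tendsto (fun v : ℕ => ((v:ℝ)+b)^2 / (4 * (v:ℝ)^2 - 1)) atTop (nhds (1/4)) := by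
    have i : Tendsto (fun v : ℕ => 1/(v:ℝ)) atTop (nhds 0) :=
      tendsto_natCast_atTop_atTop.const_div_atTop 1
    have := (((i.const_mul b).const_add 1).pow 2).div ((i.pow 2).const_sub 4) (by norm_num)
    have h : ((1 + b * 0)^2 / (4 - 0^2) : ℝ) = 1/4 := by norm_num
    rw [h] at this
    refine this.congr' ?_
    filter_upwards [eventually_ge_atTop 1] with v hv
    have hv' : (1:ℝ) ≤ v := by exact_mod_cast hv
    have h1 : 4 * (v:ℝ)^2 - 1 ≠ 0 := by nlinarith
    have h2 : 4 - (1/(v:ℝ))^2 = (4 * (v:ℝ)^2 - 1) / (v:ℝ)^2 := by field_simp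
    have h3 : 1 + b * (1/(v:ℝ)) = (v + b)/v := by field_simp
    simp only [Pi.div_apply]
    rw [h2, h3]
    field_simp
  have key := (((LR_lim b).mul (sum_lim b hb0 hb1)).const_sub 2).sub
    (((LR_lim b).mul (q.mul hl)).const_mul 8)
  have e : (2 - 2 * 1 - 8 * (2 * (1/4 * l)) : ℝ) = -4 * l := by ring
  rw [e] at key
  refine key.congr' ?_
  filter_upwards [(N_top b).eventually_ge_atTop 1, eventually_ge_atTop 12] with v h1 h2
  have h2' : (12:ℝ) ≤ v := by exact_mod_cast h2
  have f := Int.floor_le (((v : ℝ) + b) / Real.sqrt 2)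
  have hle : ((v : ℝ) + b) / Real.sqrt 2 ≤ v - 2 := by
    have s : (1.4:ℝ) ≤ Real.sqrt 2 := Real.le_sqrt_of_sq_le (by norm_num)
    rw [div_le_iff₀ (by positivity)]
    nlinarith
  have hle2 : (⌊((v : ℝ) + b) / Real.sqrt 2⌋ : ℝ) + 1 ≤ (v:ℝ) := by linarith
  have hle3 : ⌊((v : ℝ) + b) / Real.sqrt 2⌋ + 1 ≤ (v:ℤ) := by exact_mod_cast hle2
  have h1' : (1:ℝ) ≤ (⌊((v : ℝ) + b) / Real.sqrt 2⌋ : ℝ) := by exact_mod_cast h1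
  have hT : Tderiv b v = 4 * (1 / (2 * (⌊((v : ℝ) + b) / Real.sqrt 2⌋ : ℝ) + 1)^2 -
    4 * ∑ n ∈ Finset.Icc (⌊((v : ℝ) + b) / Real.sqrt 2⌋ + 1) (v : ℤ), aTerm ((v:ℝ)+b) n) := rfl
  have hins : Finset.Icc (⌊((v : ℝ) + b) / Real.sqrt 2⌋ + 1) (v : ℤ) =
      insert (v:ℤ) (Finset.Icc (⌊((v : ℝ) + b) / Real.sqrt 2⌋ + 1) ((v : ℤ) - 1)) := by
    ext x; simp only [Finset.mem_Icc, Finset.mem_insert]; omega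
  rw [hT, hins, Finset.sum_insert (by simp)]
  have hav : aTerm ((v:ℝ)+b) (v:ℤ) = 1 / (4 * (v:ℝ)^2 - 1) *
      (1 / (2 * (⌊Real.sqrt (((v:ℝ)+b)^2 - ((v:ℤ):ℝ)^2)⌋ : ℝ) + 1)) := by
    unfold aTerm; rw [one_div_mul_one_div]; push_cast; rfl
  rw [hav]
  generalize (1 / (2 * (⌊Real.sqrt (((v:ℝ)+b)^2 - ((v:ℤ):ℝ)^2)⌋ : ℝ) + 1)) = X
  generalize ∑ n ∈ Finset.Icc (⌊((v : ℝ) + b) / Real.sqrt 2⌋ + 1) ((v : ℤ) - 1),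
    aTerm ((v:ℝ)+b) n = Y
  generalize (⌊((v : ℝ) + b) / Real.sqrt 2⌋ : ℝ) = N at *
  have hR : (v:ℝ) + b ≠ 0 := by linarith
  have hL : 2 * N + 1 ≠ 0 := by linarith
  have h4 : 4 * (v:ℝ)^2 - 1 ≠ 0 := by nlinarith
  field_simp
  ring

/-- Fix `b ∈ [0,1)`.  As `v → ∞`, the quantity `(1/2)(2v₁+1)²·𝒯′((v+b)²)`
converges to `−4` if `b = 0`, and to `0` if `b > 0`. -/
theorem Tderiv_asymptotics (b : ℝ) (hb : b ∈ Set.Ico (0:ℝ) 1) :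
    (b = 0 →
      Tendsto
        (fun v : ℕ =>
          (1/2) * (2 * (⌊((v : ℝ) + b) / Real.sqrt 2⌋ : ℝ) + 1)^2 * Tderiv b v)
        atTop (nhds (-4))) ∧
    (0 < b →
      Tendsto
        (fun v : ℕ =>
          (1/2) * (2 * (⌊((v : ℝ) + b) / Real.sqrt 2⌋ : ℝ) + 1)^2 * Tderiv b v)
        atTop (nhds 0)) := by
  obtain ⟨hb0, hb1⟩ := hb
  constructor
  · intro h
    have := main_lim b hb0 hb1 1 (by subst h; simp)
    simpa using this
  · intro h
    have := main_lim b hb0 hb1 0 ?_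
    · simpa using this
    apply Tendsto.const_div_atTop
    apply tendsto_atTop_add_const_right
    apply Tendsto.const_mul_atTop (by norm_num)
    refine tendsto_intCast_atTop_atTop.comp (tendsto_floor_atTop.comp
      (Real.tendsto_sqrt_atTop.comp ?_))
    have h2 : Tendsto (fun v : ℕ => (2 * b) * (v:ℝ) + b^2) atTop atTop :=
      tendsto_atTop_add_const_right _ _
        (tendsto_natCast_atTop_atTop.const_mul_atTop (by positivity))
    refine h2.congr fun v => ?_
    push_cast
    ring
end

section
/- Let ν(λ) = (1/(2π))·arccos(λ/2) and define the first-order recurrence time t*(λ) = min{k ∈ ℕ : k > 4 and dist(k·ν(λ), ℕ) ≤ dist(4·ν(λ), ℕ)}, where dist(x, ℕ) is the distance from x to the set of natural numbers. Then t*(λ) = π/λ + O(1) as λ → 0⁺; that is, there exist C > 0 and λ₀ > 0 such that |t*(λ) − π/λ| ≤ C for all 0 < λ < λ₀. -/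
open Filter Topology

/-- The rotation number `ν(λ) = arccos(λ/2)/(2π)`. -/
noncomputable def nu (lam : ℝ) : ℝ := Real.arccos (lam / 2) / (2 * Real.pi)

/-- The distance from `x ∈ ℝ` to the set of natural numbers. -/
noncomputable def distNat (x : ℝ) : ℝ := Metric.infDist x (Set.range ((↑·) : ℕ → ℝ))

/-- The first-order recurrence time
`t*(λ) = min{k ∈ ℕ : k > 4 and dist(kν, ℕ) ≤ dist(4ν, ℕ)}`. -/
noncomputable def tstar (lam : ℝ) : ℕ :=
  sInf {k : ℕ | 4 < k ∧ distNat ((k : ℝ) * nu lam) ≤ distNat (4 * nu lam)}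

lemma distNat_le (x : ℝ) (n : ℕ) : distNat x ≤ |x - n| := by
  unfold distNat
  rw [← Real.dist_eq]
  exact Metric.infDist_le_dist_of_mem ⟨n, rfl⟩

lemma le_distNat (x c : ℝ) (h : ∀ n : ℕ, c ≤ |x - n|) : c ≤ distNat x := by
  unfold distNat
  rw [Metric.le_infDist (Set.range_nonempty _)]
  rintro _ ⟨n, rfl⟩
  rw [Real.dist_eq]
  exact h n

lemma distNat_four (d : ℝ) (hd : 0 < d) (hd2 : d ≤ 1/80) : distNat (4 * (1/4 - d)) = 4 * d := by
  apply le_antisymm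
  · refine (distNat_le _ 1).trans ?_
    rw [abs_le]; push_cast; constructor <;> linarith
  · apply le_distNat
    intro n
    rcases Nat.eq_zero_or_pos n with h | h
    · subst h
      rw [le_abs]; left; push_cast; linarith
    · have : (1:ℝ) ≤ n := by exact_mod_cast h
      rw [le_abs]; right; linarith

lemma lower (d : ℝ) (hd : 0 < d) (hd2 : d ≤ 1/80) (k : ℕ) (hk : 4 < k)
    (h : distNat ((k:ℝ) * (1/4 - d)) ≤ 4 * d) : 1/4 ≤ k * d + 4 * d := by
  by_contra! hc
  have hk5 : (5:ℝ) ≤ k := by exact_mod_cast hk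
  have hkd : 5 * d ≤ k * d := by nlinarith
  have h1 : min (5 * d) (1/4 - k * d) ≤ distNat ((k:ℝ) * (1/4 - d)) := by
    apply le_distNat
    intro n
    rcases Nat.lt_or_ge (4 * n) k with h | h
    · have : (4 * n + 1 : ℝ) ≤ k := by exact_mod_cast h
      refine (min_le_right _ _).trans ?_
      rw [le_abs]; left; linarith
    · have : (k : ℝ) ≤ 4 * n := by exact_mod_cast h
      refine (min_le_left _ _).trans ?_
      rw [le_abs]; right; linarith
  have h2 : 4 * d < min (5 * d) (1/4 - k * d) := lt_min (by linarith) (by linarith)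
  linarith

lemma upper (d : ℝ) (hd : 0 < d) (hd2 : d ≤ 1/80) :
    ∃ k : ℕ, 4 < k ∧ distNat ((k:ℝ) * (1/4 - d)) ≤ 4 * d ∧ k * d ≤ 1/4 + 4 * d := by
  have hX : 20 ≤ 1 / (4 * d) := by rw [le_div_iff₀ (by linarith)]; linarith
  set X := 1 / (4 * d) with hXd
  have hXe : X * d = 1/4 := by rw [hXd]; field_simp
  set m := ⌊X / 4⌋₊ with hm
  have h1 : (m:ℝ) ≤ X / 4 := Nat.floor_le (by linarith)
  have h2 : X / 4 < m + 1 := Nat.lt_floor_add_one _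
  have h3 : 1 ≤ m := by
    have : (0:ℝ) < m := by linarith
    exact_mod_cast this
  have e1 : (m:ℝ) * d ≤ 1/16 := by nlinarith
  have e2 : 1/16 ≤ (m:ℝ) * d + d := by nlinarith
  refine ⟨4 * m + 1, by omega, (distNat_le _ m).trans ?_, ?_⟩
  · rw [abs_le]; push_cast; constructor <;> nlinarith
  · push_cast; nlinarith

lemma inv_est (t : ℝ) (h0 : 0 < t) (h1 : t ≤ 1/10) :
    |Real.pi / (2 * t) - Real.pi / (2 * Real.sin t)| ≤ 1 := by
  have hs : t - t ^ 3 / 4 < Real.sin t := by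
    have h6 := Real.sin_gt_sub_cube h0
    have h7 : 0 < t ^ 3 := by positivity
    linarith
  have hs2 := Real.sin_lt h0
  have hp := Real.pi_lt_four
  have hp0 := Real.pi_pos
  have hs3 : t / 2 ≤ Real.sin t := by nlinarith [sq_nonneg t, mul_pos h0 h0]
  set s := Real.sin t
  have hs0 : 0 < s := by linarith
  have : Real.pi / (2 * t) - Real.pi / (2 * s) = - (Real.pi * (t - s) / (2 * t * s)) := by
    field_simp; ring
  rw [this, abs_neg, abs_of_nonneg (by apply div_nonneg <;> nlinarith [mul_pos h0 hs0])]
  rw [div_le_one (by positivity)]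
  have a : Real.pi * (t - s) ≤ 4 * (t^3/4) :=
    mul_le_mul (by linarith) (by linarith) (by linarith) (by norm_num)
  have b : t * (t/2) ≤ t * s := mul_le_mul_of_nonneg_left hs3 h0.le
  nlinarith [mul_pos h0 h0]

/-- `t*(λ) = π/λ + O(1)` as `λ → 0⁺`: there are `C > 0`, `λ₀ > 0` such that
`|t*(λ) − π/λ| ≤ C` for all `0 < λ < λ₀`. -/
theorem tstar_asymptotics :
    ∃ C > (0:ℝ), ∃ lam0 > (0:ℝ), ∀ lam : ℝ, 0 < lam → lam < lam0 →
      |(tstar lam : ℝ) - Real.pi / lam| ≤ C := by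
  refine ⟨5, by norm_num, 1/10, by norm_num, fun lam h0 h1 => ?_⟩
  have hp0 := Real.pi_pos
  have hp := Real.pi_lt_four
  set t := Real.arcsin (lam / 2) with ht
  have hsin : Real.sin t = lam / 2 := Real.sin_arcsin (by linarith) (by linarith)
  have ht0 : 0 < t := Real.arcsin_pos.2 (by linarith)
  have htl : t ≤ Real.pi * lam / 4 := by
    have := Real.mul_le_sin ht0.le (Real.arcsin_le_pi_div_two _)
    rw [hsin, div_mul_eq_mul_div, div_le_iff₀ hp0] at this
    linarith
  have ht1 : t ≤ 1/10 := by nlinarith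
  set d := t / (2 * Real.pi) with hd
  have hd0 : 0 < d := by positivity
  have hd2 : d ≤ 1/80 := by
    rw [hd, div_le_iff₀ (by positivity)]
    nlinarith
  have hnu : nu lam = 1/4 - d := by
    unfold nu
    rw [Real.arccos_eq_pi_div_two_sub_arcsin, ← ht, hd]
    field_simp; ring
  have hset : tstar lam = sInf {k : ℕ | 4 < k ∧ distNat ((k : ℝ) * (1/4 - d)) ≤ 4 * d} := by
    unfold tstar
    rw [hnu, distNat_four d hd0 hd2]
  obtain ⟨k, hk4, hkd, hku⟩ := upper d hd0 hd2
  have hmem := Nat.sInf_mem (s := {k : ℕ | 4 < k ∧ distNat ((k : ℝ) * (1/4 - d)) ≤ 4 * d})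
    ⟨k, hk4, hkd⟩
  have hle := Nat.sInf_le (s := {k : ℕ | 4 < k ∧ distNat ((k : ℝ) * (1/4 - d)) ≤ 4 * d})
    (m := k) ⟨hk4, hkd⟩
  rw [← hset] at hmem hle
  have hlow := lower d hd0 hd2 _ hmem.1 hmem.2
  have hle' : (tstar lam : ℝ) ≤ k := by exact_mod_cast hle
  have hup : (tstar lam : ℝ) * d ≤ 1/4 + 4 * d :=
    (mul_le_mul_of_nonneg_right hle' hd0.le).trans hku
  have hest := inv_est t ht0 ht1
  rw [hsin, show 2 * (lam / 2) = lam by ring] at hest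
  set X := Real.pi / (2 * t) with hX
  have hXd : X * d = 1/4 := by rw [hX, hd]; field_simp; norm_num
  have u1 : (tstar lam : ℝ) ≤ X + 4 := by
    refine le_of_mul_le_mul_right ?_ hd0
    linarith
  have u2 : X ≤ (tstar lam : ℝ) + 4 := by
    refine le_of_mul_le_mul_right ?_ hd0
    linarith
  rw [abs_le] at hest ⊢
  constructor <;> linarith [hest.1, hest.2]
end
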